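/- arXiv:1306.1278 — 3 statements merged into one kernel-verified Lean document; each statement's English description precedes it below -/
import Mathlib

section
/- Let α : ℝ → ℝ be continuous and positive, L > 0, M > 0, and define B(ξ) = ∫₀^ξ s α(s) ds. Suppose B(ξ) → ∞ as ξ → +∞ and as ξ → −∞. Let ψ ≡ M be the constant modulus on (0,L/2). Then for every z ∈ (0,L/2) and t > 0, the minimal supersolution satisfies inf{ξ : B(ξ) ≤ M²/t} ≤ ∂_x ψ₊(z,t) ≤ sup{ξ : B(ξ) ≤ M²/t}. -/
open Set Real Filter

/-- Partial derivative in the spatial variable. -/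
noncomputable def pderivX (u : ℝ → ℝ → ℝ) (x t : ℝ) : ℝ := deriv (fun y => u y t) x

/-- Second partial derivative in the spatial variable. -/
noncomputable def pderivXX (u : ℝ → ℝ → ℝ) (x t : ℝ) : ℝ := deriv (fun y => pderivX u y t) x

/-- Partial derivative in the time variable. -/
noncomputable def pderivT (u : ℝ → ℝ → ℝ) (x t : ℝ) : ℝ := deriv (fun s => u x s) t

/-- `u` is regular on `S`: it is continuous, has spatial derivatives up to second order and a
first time derivative on `S`, and these are continuous on `S`. -/
def RegularOn (u : ℝ → ℝ → ℝ) (S : Set (ℝ × ℝ)) : Prop :=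
  ContinuousOn (fun p : ℝ × ℝ => u p.1 p.2) S ∧
  (∀ p ∈ S, DifferentiableAt ℝ (fun y => u y p.2) p.1) ∧
  (∀ p ∈ S, DifferentiableAt ℝ (fun y => pderivX u y p.2) p.1) ∧
  (∀ p ∈ S, DifferentiableAt ℝ (fun s => u p.1 s) p.2) ∧
  ContinuousOn (fun p : ℝ × ℝ => pderivX u p.1 p.2) S ∧
  ContinuousOn (fun p : ℝ × ℝ => pderivXX u p.1 p.2) S ∧
  ContinuousOn (fun p : ℝ × ℝ => pderivT u p.1 p.2) S

/-- `ψ` is a modulus of continuity for the `L`-periodic function `u`. -/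
def IsModulus (L : ℝ) (ψ : ℝ → ℝ) (u : ℝ → ℝ) : Prop :=
  ∀ x y : ℝ, 0 < y - x → y - x < L →
    -(2 * ψ ((L + x - y) / 2)) ≤ u y - u x ∧ u y - u x ≤ 2 * ψ ((y - x) / 2)

/-- Membership in the class `S_ψ` of supersolutions of `∂ₜφ = α(φ')φ''` on
`[0, L/2] × [0, ∞)` lying above `ψ` at time `0`. -/
def MemS (α : ℝ → ℝ) (L : ℝ) (ψ : ℝ → ℝ) (φ : ℝ → ℝ → ℝ) : Prop :=
  (∀ z t : ℝ, z ∈ Icc 0 (L/2) → 0 ≤ t → 0 ≤ φ z t) ∧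
  ContinuousOn (fun p : ℝ × ℝ => φ p.1 p.2)
    ((Icc 0 (L/2) ×ˢ Ici 0) \ {((0:ℝ), (0:ℝ)), ((L/2 : ℝ), (0:ℝ))}) ∧
  RegularOn φ (Ioo 0 (L/2) ×ˢ Ioi 0) ∧
  (∀ z t : ℝ, z ∈ Ioo 0 (L/2) → 0 < t →
    α (pderivX φ z t) * pderivXX φ z t ≤ pderivT φ z t) ∧
  (∀ z ∈ Ioo (0:ℝ) (L/2), ψ z ≤ φ z 0)

/-- The minimal supersolution `ψ₊`. -/
noncomputable def psiPlus (α : ℝ → ℝ) (L : ℝ) (ψ : ℝ → ℝ) (z t : ℝ) : ℝ :=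
  sInf {y : ℝ | ∃ φ : ℝ → ℝ → ℝ, MemS α L ψ φ ∧ φ z t = y}

section Supersolutions

open Topology

/-! ### The infimum defining `psiPlus` -/

lemma psiPlus_le {α : ℝ → ℝ} {L : ℝ} {ψ : ℝ → ℝ} {φ : ℝ → ℝ → ℝ} (hφ : MemS α L ψ φ)
    {z t : ℝ} (hz : z ∈ Icc 0 (L / 2)) (ht : 0 ≤ t) : psiPlus α L ψ z t ≤ φ z t := by
  refine csInf_le ⟨0, ?_⟩ ⟨φ, hφ, rfl⟩
  rintro y ⟨χ, hχ, rfl⟩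
  exact hχ.1 z t hz ht

/-! ### Parabolic scaling and reflection of supersolutions -/

lemma MemS.scale {α : ℝ → ℝ} {L M : ℝ} (hM : 0 ≤ M) {φ : ℝ → ℝ → ℝ}
    (hφ : MemS α L (fun _ => M) φ) {μ : ℝ} (hμ : 0 < μ) (hμ1 : μ ≤ 1) :
    MemS α L (fun _ => M) (fun x t => μ⁻¹ * φ (μ * x) (μ ^ 2 * t)) := by
  obtain ⟨h0, hc, ⟨r0, r1, r2, r3, r4, r5, r6⟩, hs, hi⟩ := hφ
  have hμ0 : μ ≠ 0 := hμ.ne'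
  have eX : ∀ x t, pderivX (fun x t => μ⁻¹ * φ (μ * x) (μ ^ 2 * t)) x t =
      pderivX φ (μ * x) (μ ^ 2 * t) := by
    intro x t
    simp only [pderivX]
    rw [deriv_const_mul_field, deriv_comp_mul_left (c := μ) (f := fun y => φ y (μ ^ 2 * t))]
    simp [hμ0]
  have eXX : ∀ x t, pderivXX (fun x t => μ⁻¹ * φ (μ * x) (μ ^ 2 * t)) x t =
      μ * pderivXX φ (μ * x) (μ ^ 2 * t) := by
    intro x t
    simp only [pderivXX, eX]
    rw [deriv_comp_mul_left (c := μ) (f := fun y => pderivX φ y (μ ^ 2 * t))]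
    simp
  have eT : ∀ x t, pderivT (fun x t => μ⁻¹ * φ (μ * x) (μ ^ 2 * t)) x t =
      μ * pderivT φ (μ * x) (μ ^ 2 * t) := by
    intro x t
    simp only [pderivT]
    rw [deriv_const_mul_field, deriv_comp_mul_left (c := μ ^ 2) (f := fun s => φ (μ * x) s)]
    simp only [smul_eq_mul]
    field_simp
  have hcont : Continuous fun p : ℝ × ℝ => (μ * p.1, μ ^ 2 * p.2) := by fun_prop
  have mIoo : ∀ {x}, x ∈ Ioo 0 (L / 2) → μ * x ∈ Ioo 0 (L / 2) := fun {x} hx =>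
    ⟨mul_pos hμ hx.1, by nlinarith [hx.1, hx.2]⟩
  have mIcc : ∀ {x}, x ∈ Icc 0 (L / 2) → μ * x ∈ Icc 0 (L / 2) := fun {x} hx =>
    ⟨mul_nonneg hμ.le hx.1, by nlinarith [hx.1, hx.2]⟩
  have mt : ∀ {t : ℝ}, 0 < t → 0 < μ ^ 2 * t := fun {t} ht => by positivity
  have mdom : MapsTo (fun p : ℝ × ℝ => (μ * p.1, μ ^ 2 * p.2))
      (Ioo 0 (L / 2) ×ˢ Ioi 0) (Ioo 0 (L / 2) ×ˢ Ioi 0) := fun p hp => ⟨mIoo hp.1, mt hp.2⟩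
  refine ⟨?_, ?_, ⟨?_, ?_, ?_, ?_, ?_, ?_, ?_⟩, ?_, ?_⟩
  · intro z t hz ht
    exact mul_nonneg (inv_pos.2 hμ).le (h0 _ _ (mIcc hz) (by positivity))
  · refine ContinuousOn.mul continuousOn_const (hc.comp hcont.continuousOn ?_)
    rintro ⟨x, t⟩ ⟨⟨hx, ht⟩, hne⟩
    simp only [mem_insert_iff, mem_singleton_iff, Prod.mk.injEq, not_or, not_and, mem_Ici,
      mem_Icc] at hx ht hne
    refine ⟨⟨mIcc hx, mem_Ici.2 (by simp only; positivity)⟩, ?_⟩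
    simp only [mem_insert_iff, mem_singleton_iff, Prod.mk.injEq, not_or, not_and, mul_eq_zero,
      hμ0, false_or, pow_eq_zero_iff, ne_eq, OfNat.ofNat_ne_zero, not_false_eq_true]
    exact ⟨hne.1, fun h => hne.2 (le_antisymm hx.2 (by nlinarith [hx.1]))⟩
  · exact ContinuousOn.mul continuousOn_const (r0.comp hcont.continuousOn mdom)
  · intro p hp
    have := r1 _ (mdom hp)
    exact (DifferentiableAt.comp (f := fun x => μ * x) p.1 this (by fun_prop)).const_mul _
  · intro p hp
    simp only [eX]
    have := r2 _ (mdom hp)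
    exact DifferentiableAt.comp (f := fun x => μ * x) p.1 this (by fun_prop)
  · intro p hp
    have := r3 _ (mdom hp)
    exact (DifferentiableAt.comp (f := fun x => μ ^ 2 * x) p.2 this (by fun_prop)).const_mul _
  · simp only [eX]
    exact r4.comp hcont.continuousOn mdom
  · simp only [eXX]
    exact ContinuousOn.mul continuousOn_const (r5.comp hcont.continuousOn mdom)
  · simp only [eT]
    exact ContinuousOn.mul continuousOn_const (r6.comp hcont.continuousOn mdom)
  · intro z t hz ht
    rw [eX, eXX, eT]
    have := mul_le_mul_of_nonneg_left (hs _ _ (mIoo hz) (mt ht)) hμ.le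
    linarith
  · intro z hz
    have h1 := hi _ (mIoo hz)
    simp only [mul_zero]
    calc M ≤ μ⁻¹ * M := le_mul_of_one_le_left hM ((one_le_inv₀ hμ).2 hμ1)
      _ ≤ _ := mul_le_mul_of_nonneg_left h1 (inv_pos.2 hμ).le

lemma MemS.reflect {α : ℝ → ℝ} {L M : ℝ} {φ : ℝ → ℝ → ℝ}
    (hφ : MemS α L (fun _ => M) φ) :
    MemS (fun p => α (-p)) L (fun _ => M) (fun x t => φ (L / 2 - x) t) := by
  obtain ⟨h0, hc, ⟨r0, r1, r2, r3, r4, r5, r6⟩, hs, hi⟩ := hφ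
  have eX : ∀ x t, pderivX (fun x t => φ (L / 2 - x) t) x t = -pderivX φ (L / 2 - x) t := by
    intro x t
    simp only [pderivX]
    exact deriv_comp_const_sub (f := fun y => φ y t) (L / 2) x
  have eXX : ∀ x t, pderivXX (fun x t => φ (L / 2 - x) t) x t =
      pderivXX φ (L / 2 - x) t := by
    intro x t
    simp only [pderivXX, eX, deriv.fun_neg]
    rw [deriv_comp_const_sub (f := fun y => pderivX φ y t), neg_neg]
  have eT : ∀ x t, pderivT (fun x t => φ (L / 2 - x) t) x t = pderivT φ (L / 2 - x) t :=
    fun _ _ => rfl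
  have hcont : Continuous fun p : ℝ × ℝ => (L / 2 - p.1, p.2) := by fun_prop
  have mIoo : ∀ {x}, x ∈ Ioo 0 (L / 2) → L / 2 - x ∈ Ioo 0 (L / 2) := fun {x} hx =>
    ⟨by linarith [hx.2], by linarith [hx.1]⟩
  have mIcc : ∀ {x}, x ∈ Icc 0 (L / 2) → L / 2 - x ∈ Icc 0 (L / 2) := fun {x} hx =>
    ⟨by linarith [hx.2], by linarith [hx.1]⟩
  have mdom : MapsTo (fun p : ℝ × ℝ => (L / 2 - p.1, p.2))
      (Ioo 0 (L / 2) ×ˢ Ioi 0) (Ioo 0 (L / 2) ×ˢ Ioi 0) := fun p hp => ⟨mIoo hp.1, hp.2⟩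
  refine ⟨fun z t hz ht => h0 _ _ (mIcc hz) ht, ?_, ⟨?_, ?_, ?_, ?_, ?_, ?_, ?_⟩, ?_,
    fun z hz => hi _ (mIoo hz)⟩
  · refine hc.comp hcont.continuousOn ?_
    rintro ⟨x, t⟩ ⟨⟨hx, ht⟩, hne⟩
    simp only [mem_insert_iff, mem_singleton_iff, Prod.mk.injEq, not_or, not_and] at hne
    refine ⟨⟨mIcc hx, ht⟩, ?_⟩
    simp only [mem_insert_iff, mem_singleton_iff, Prod.mk.injEq, not_or, not_and]
    exact ⟨fun h => hne.2 (by linarith), fun h => hne.1 (by linarith)⟩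
  · exact r0.comp hcont.continuousOn mdom
  · intro p hp
    have := r1 _ (mdom hp)
    exact DifferentiableAt.comp (f := fun x => L / 2 - x) p.1 this (by fun_prop)
  · intro p hp
    simp only [eX]
    have := r2 _ (mdom hp)
    exact (DifferentiableAt.comp (f := fun x => L / 2 - x) p.1 this (by fun_prop)).neg
  · intro p hp
    exact r3 _ (mdom hp)
  · simp only [eX]
    exact (r4.comp hcont.continuousOn mdom).neg
  · simp only [eXX]
    exact r5.comp hcont.continuousOn mdom
  · simp only [eT]
    exact r6.comp hcont.continuousOn mdom
  · intro z t hz ht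
    rw [eX, eXX, eT]
    simp only [neg_neg]
    exact hs _ _ (mIoo hz) ht

lemma psiPlus_reflect (α : ℝ → ℝ) (L M z t : ℝ) :
    psiPlus α L (fun _ => M) z t =
      psiPlus (fun p => α (-p)) L (fun _ => M) (L / 2 - z) t := by
  unfold psiPlus
  congr 1
  ext y
  constructor
  · rintro ⟨φ, hφ, rfl⟩
    exact ⟨_, hφ.reflect, by simp⟩
  · rintro ⟨φ, hφ, rfl⟩
    exact ⟨_, by simpa using hφ.reflect, rfl⟩

/-! ### Monotonicity of `z ↦ ψ₊(z, t) / z` -/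

lemma deriv_deriv_nonneg_of_isLocalMin {f : ℝ → ℝ} {x : ℝ} (h : IsLocalMin f x)
    (hf : ContinuousAt f x) : 0 ≤ deriv (deriv f) x := by
  by_contra! hneg
  have hmax := isLocalMax_of_deriv_deriv_neg hneg h.deriv_eq_zero hf
  have hconst : f =ᶠ[𝓝 x] fun _ => f x := by
    filter_upwards [h, hmax] with y h1 h2 using le_antisymm h2 h1
  have : deriv (deriv f) x = 0 := by
    rw [hconst.deriv.deriv_eq]
    simp
  exact hneg.ne this

lemma deriv_nonpos_of_eventually_ge_left {f : ℝ → ℝ} {x d : ℝ} (hf : HasDerivAt f d x)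
    (h : ∀ᶠ y in 𝓝[<] x, f x ≤ f y) : d ≤ 0 := by
  have ht : Tendsto (slope f x) (𝓝[<] x) (𝓝 d) :=
    hf.tendsto_slope.mono_left (nhdsWithin_mono _ fun y hy => ne_of_lt hy)
  refine le_of_tendsto ht ?_
  filter_upwards [h, self_mem_nhdsWithin] with y h1 h2
  rw [slope_def_field]
  exact div_nonpos_of_nonneg_of_nonpos (by linarith) (by linarith [mem_Iio.1 h2])

/-- A supersolution which dominates a linear function along the parabola `y = z √(s / t)`
dominates it on the whole region between the axis `y = 0` and the parabola. -/
lemma MemS.linear_le {α : ℝ → ℝ} (hα : ∀ p, 0 < α p) {L : ℝ} {ψ : ℝ → ℝ} {φ : ℝ → ℝ → ℝ}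
    (hφ : MemS α L ψ φ) {z t k : ℝ} (hz : z ∈ Ioo 0 (L / 2)) (ht : 0 < t)
    (hk : ∀ s ∈ Ioc 0 t, k * (z * √(s / t)) ≤ φ (z * √(s / t)) s)
    {y : ℝ} (hy : y ∈ Ioo 0 z) : k * y ≤ φ y t := by
  obtain ⟨h0, hc, ⟨r0, r1, r2, r3, r4, r5, r6⟩, hs, hi⟩ := hφ
  refine le_of_forall_pos_le_add fun e he => ?_
  set η := e / (1 + t) with hη
  have hηpos : 0 < η := by positivity
  have hηe : η * (1 + t) = e := by rw [hη]; field_simp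
  set f : ℝ × ℝ → ℝ := fun q => φ q.1 q.2 - k * q.1 + η * (1 + q.2) with hf
  suffices 0 ≤ f (y, t) by simp only [hf] at this; linarith
  by_contra! hneg
  obtain ⟨δ, hδ, hδt, hδη⟩ : ∃ δ, 0 < δ ∧ δ < t ∧ |k| * (z * √(δ / t)) < η := by
    have hlim : Tendsto (fun δ : ℝ => |k| * (z * √(δ / t))) (𝓝[>] 0) (𝓝 0) := by
      have : Continuous fun δ : ℝ => |k| * (z * √(δ / t)) := by fun_prop
      simpa using (this.tendsto 0).mono_left nhdsWithin_le_nhds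
    obtain ⟨δ, h1, h2⟩ := ((hlim.eventually (gt_mem_nhds hηpos)).and
      (Ioo_mem_nhdsGT ht)).exists
    exact ⟨δ, h2.1, h2.2, h1⟩
  have hsq : ∀ {s}, s ≤ t → √(s / t) ≤ 1 := fun {s} hst =>
    Real.sqrt_le_one.2 ((div_le_one ht).2 hst)
  set K : Set (ℝ × ℝ) := {q | q ∈ Icc 0 z ×ˢ Icc δ t ∧ q.1 ≤ z * √(q.2 / t)} with hK
  have hKc : IsCompact K := by
    refine (isCompact_Icc.prod isCompact_Icc).inter_right
      (isClosed_le continuous_fst (by fun_prop))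
  have hyK : (y, t) ∈ K := by
    refine ⟨⟨⟨hy.1.le, hy.2.le⟩, hδt.le, le_rfl⟩, ?_⟩
    simp [div_self ht.ne', hy.2.le]
  have hfc : ContinuousOn f K := by
    refine ContinuousOn.add (ContinuousOn.sub (hc.mono ?_) (by fun_prop)) (by fun_prop)
    rintro ⟨x, s⟩ ⟨⟨hx, hs⟩, -⟩
    have hs0 : 0 < s := hδ.trans_le hs.1
    refine ⟨⟨⟨hx.1, hx.2.trans hz.2.le⟩, hs0.le⟩, ?_⟩
    simp [hs0.ne']
  obtain ⟨⟨x, s⟩, ⟨⟨hx, hsI⟩, hxs⟩, hmin⟩ := hKc.exists_isMinOn ⟨_, hyK⟩ hfc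
  simp only at hx hsI hxs
  have hfneg : f (x, s) < 0 := (hmin hyK).trans_lt hneg
  have hs0 : 0 < s := hδ.trans_le hsI.1
  have hφ0 : 0 ≤ φ x s := h0 x s ⟨hx.1, hx.2.trans hz.2.le⟩ hs0.le
  have hηs : η ≤ η * (1 + s) := by nlinarith
  have hsδ : δ < s := by
    refine lt_of_le_of_ne hsI.1 fun h => ?_
    subst h
    have : k * x ≤ |k| * (z * √(δ / t)) :=
      mul_le_mul (le_abs_self k) hxs hx.1 (abs_nonneg k)
    simp only [hf] at hfneg
    linarith
  have hx0 : 0 < x := by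
    refine lt_of_le_of_ne hx.1 fun h => ?_
    subst h
    simp only [hf, mul_zero] at hfneg
    linarith
  have hxlt : x < z * √(s / t) := by
    refine lt_of_le_of_ne hxs fun h => ?_
    have := hk s ⟨hs0, hsI.2⟩
    rw [← h] at this
    simp only [hf] at hfneg
    linarith
  have hxz : x < z := hxlt.trans_le (by nlinarith [hsq hsI.2, hz.1])
  have hdom : (x, s) ∈ Ioo 0 (L / 2) ×ˢ Ioi (0 : ℝ) := ⟨⟨hx0, hxz.trans hz.2⟩, hs0⟩
  have hspace : 0 ≤ pderivXX φ x s := by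
    have hloc : IsLocalMin (fun w => φ w s - k * w) x := by
      have : ∀ᶠ w in 𝓝 x, w ∈ Ioo 0 (z * √(s / t)) := Ioo_mem_nhds hx0 hxlt
      filter_upwards [this] with w hw
      have hwK : (w, s) ∈ K :=
        ⟨⟨⟨hw.1.le, hw.2.le.trans (by nlinarith [hsq hsI.2, hz.1])⟩, hsI⟩, hw.2.le⟩
      have := hmin hwK
      simp only [hf, mem_ofPred_eq] at this
      linarith
    have hnear : ∀ᶠ w in 𝓝 x, DifferentiableAt ℝ (fun w => φ w s) w := by
      filter_upwards [Ioo_mem_nhds hx0 hdom.1.2] with w hw using r1 (w, s) ⟨hw, hs0⟩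
    have h2 := deriv_deriv_nonneg_of_isLocalMin hloc
      ((r1 _ hdom).continuousAt.sub (by fun_prop))
    have heq : deriv (fun w => φ w s - k * w) =ᶠ[𝓝 x] fun w => pderivX φ w s - k := by
      filter_upwards [hnear] with w hw
      rw [deriv_fun_sub hw (by fun_prop)]
      simp [pderivX]
    rw [heq.deriv_eq, deriv_sub_const] at h2
    exact h2
  have htime : pderivT φ x s + η ≤ 0 := by
    have hd : HasDerivAt (fun w => φ x w + η * w) (pderivT φ x s + η) s := by
      exact ((r3 _ hdom).hasDerivAt.fun_add ((hasDerivAt_id s).const_mul η)).congr_deriv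
        (by simp [pderivT])
    refine deriv_nonpos_of_eventually_ge_left hd ?_
    have hc' : Continuous fun w : ℝ => z * √(w / t) := by fun_prop
    filter_upwards [Ioo_mem_nhdsLT hsδ, nhdsWithin_le_nhds
      (hc'.continuousAt.eventually (lt_mem_nhds hxlt))] with w hw hw2
    have hwK : (x, w) ∈ K := ⟨⟨hx, hw.1.le, hw.2.le.trans hsI.2⟩, hw2.le⟩
    have := hmin hwK
    simp only [hf, mem_ofPred_eq] at this
    linarith
  have := hs x s hdom.1 hs0
  have := mul_nonneg (hα (pderivX φ x s)).le hspace
  linarith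

/-- Every supersolution lies above the chords from the origin to the graph of `ψ₊(·, t)`. -/
lemma psiPlus_mul_le {α : ℝ → ℝ} (hα : ∀ p, 0 < α p) {L M : ℝ} (hM : 0 ≤ M)
    {φ : ℝ → ℝ → ℝ} (hφ : MemS α L (fun _ => M) φ) {y z t : ℝ}
    (hz : z ∈ Ioo 0 (L / 2)) (ht : 0 < t) (hy : y ∈ Ioo 0 z) :
    psiPlus α L (fun _ => M) z t / z * y ≤ φ y t := by
  refine hφ.linear_le hα hz ht (fun s hs => ?_) hy
  set μ := √(s / t) with hμ
  have hst : 0 < s / t := div_pos hs.1 ht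
  have hμ0 : 0 < μ := Real.sqrt_pos.2 hst
  have hμ1 : μ ≤ 1 := Real.sqrt_le_one.2 ((div_le_one ht).2 hs.2)
  have hμt : μ ^ 2 * t = s := by
    rw [hμ, Real.sq_sqrt hst.le, div_mul_cancel₀ _ ht.ne']
  have h := psiPlus_le (hφ.scale hM hμ0 hμ1) (Ioo_subset_Icc_self hz) ht.le
  simp only [hμt] at h
  have hz0 := hz.1.ne'
  rw [mul_comm z μ]
  calc psiPlus α L (fun _ => M) z t / z * (μ * z)
      = μ * psiPlus α L (fun _ => M) z t := by field_simp
    _ ≤ μ * (μ⁻¹ * φ (μ * z) s) := mul_le_mul_of_nonneg_left h hμ0.le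
    _ = φ (μ * z) s := by field_simp

/-! ### Barriers -/

lemma hasDerivAt_max_zero_sq (y : ℝ) :
    HasDerivAt (fun y : ℝ => (max 0 y) ^ 2) (2 * max 0 y) y := by
  rcases lt_trichotomy y 0 with h | rfl | h
  · rw [max_eq_left h.le, mul_zero]
    refine (hasDerivAt_const y (0 : ℝ)).congr_of_eventuallyEq ?_
    filter_upwards [gt_mem_nhds h] with w hw
    rw [max_eq_left (le_of_lt hw)]
    norm_num
  · rw [hasDerivAt_iff_isLittleO]
    refine Asymptotics.IsBigO.trans_isLittleO (g := fun y : ℝ => y ^ 2) ?_ ?_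
    · refine Asymptotics.IsBigO.of_bound 1 (Eventually.of_forall fun w => ?_)
      simp only [max_self, sub_zero, mul_zero, smul_zero, one_mul, norm_eq_abs, abs_pow]
      norm_num
      rcases le_total 0 w with h | h <;> simp [h, sq_nonneg]
    · simpa using Asymptotics.isLittleO_pow_id (𝕜 := ℝ) one_lt_two
  · rw [max_eq_right h.le]
    refine HasDerivAt.congr_of_eventuallyEq (f := fun y : ℝ => y ^ 2) ?_ ?_
    · simpa using hasDerivAt_pow 2 y
    · filter_upwards [lt_mem_nhds h] with w hw
      rw [max_eq_right (le_of_lt hw)]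

/-- A `C¹` cutoff equal to `1` on `(-∞, N]` and to `0` on `[N + δ, ∞)`. -/
noncomputable def cutoff (N δ h : ℝ) : ℝ := (max 0 (1 - (max 0 ((h - N) / δ)) ^ 2)) ^ 2

/-- The derivative of `cutoff`. -/
noncomputable def cutoffDeriv (N δ h : ℝ) : ℝ :=
  -(4 * max 0 (1 - (max 0 ((h - N) / δ)) ^ 2) * max 0 ((h - N) / δ) / δ)

lemma hasDerivAt_cutoff (N δ h : ℝ) :
    HasDerivAt (cutoff N δ) (cutoffDeriv N δ h) h := by
  have h1 : HasDerivAt (fun h : ℝ => (h - N) / δ) (1 / δ) h :=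
    ((hasDerivAt_id h).sub_const N).div_const δ
  have h2 := ((hasDerivAt_max_zero_sq ((h - N) / δ)).comp h h1).const_sub 1
  have h3 := (hasDerivAt_max_zero_sq _).comp h h2
  refine h3.congr_deriv ?_
  simp only [cutoffDeriv, Function.comp]
  ring

lemma continuous_cutoff (N δ : ℝ) : Continuous (cutoff N δ) := by
  unfold cutoff; fun_prop

lemma continuous_cutoffDeriv (N δ : ℝ) : Continuous (cutoffDeriv N δ) := by
  unfold cutoffDeriv; fun_prop

lemma cutoff_nonneg (N δ h : ℝ) : 0 ≤ cutoff N δ h := sq_nonneg _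

lemma cutoff_le_one (N δ h : ℝ) : cutoff N δ h ≤ 1 := by
  unfold cutoff
  have h1 : max 0 (1 - (max 0 ((h - N) / δ)) ^ 2) ≤ 1 :=
    max_le zero_le_one (by linarith [sq_nonneg (max 0 ((h - N) / δ))])
  have h0 := le_max_left 0 (1 - (max 0 ((h - N) / δ)) ^ 2)
  nlinarith

lemma cutoff_of_le {N δ h : ℝ} (hδ : 0 < δ) (hh : h ≤ N) : cutoff N δ h = 1 := by
  have : max 0 ((h - N) / δ) = 0 :=
    max_eq_left (div_nonpos_of_nonpos_of_nonneg (by linarith) hδ.le)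
  simp [cutoff, this]

lemma cutoff_of_ge {N δ h : ℝ} (hδ : 0 < δ) (hh : N + δ ≤ h) :
    cutoff N δ h = 0 ∧ cutoffDeriv N δ h = 0 := by
  have h1 : 1 ≤ (h - N) / δ := by rw [le_div_iff₀ hδ]; linarith
  have h2 : 1 ≤ max 0 ((h - N) / δ) := h1.trans (le_max_right _ _)
  have h3 : max 0 (1 - (max 0 ((h - N) / δ)) ^ 2) = 0 := max_eq_left (by nlinarith)
  simp [cutoff, cutoffDeriv, h3]

/-- For a narrow cutoff, the concavity of the transition makes up for the change of the
diffusion coefficient under the damping of slopes. -/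
lemma exists_cutoff_width {α : ℝ → ℝ} (hα : Continuous α) (hpos : ∀ p, 0 < α p)
    {a ξ c c' : ℝ} (ha : 0 < a) (haξ : a < ξ) (hc : 0 < c) (hcc' : c < c') :
    ∃ δ₀ > 0, ∀ δ N h p p' : ℝ, 0 < δ → δ ≤ δ₀ → h < N + δ → p ∈ Icc a ξ →
      α p * p' = -c' →
      α (cutoff N δ h * p) * (cutoffDeriv N δ h * p ^ 2 + cutoff N δ h * p') ≤
        -(c * cutoff N δ h) := by
  have hξ : 0 < ξ := ha.trans haξ
  have hc' : 0 < c' := hc.trans hcc'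
  obtain ⟨q, -, hq⟩ := isCompact_Icc.exists_isMinOn (nonempty_Icc.2 hξ.le) hα.continuousOn
  set m := α q with hm
  have hm0 : 0 < m := hpos q
  have hmle : ∀ r ∈ Icc 0 ξ, m ≤ α r := fun r hr => hq hr
  have huc := isCompact_Icc.uniformContinuousOn_of_continuous (hα.continuousOn (s := Icc 0 ξ))
  obtain ⟨θ, hθ, hθα⟩ := Metric.uniformContinuousOn_iff.1 huc (m * (c' - c) / c')
    (div_pos (mul_pos hm0 (by linarith)) hc')
  obtain ⟨y₀, hy₀, hy₀θ⟩ : ∃ y₀ > 0, 2 * y₀ ^ 2 * ξ < θ := by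
    have hlim : Tendsto (fun y : ℝ => 2 * y ^ 2 * ξ) (𝓝[>] 0) (𝓝 0) := by
      have : Continuous fun y : ℝ => 2 * y ^ 2 * ξ := by fun_prop
      simpa using (this.tendsto 0).mono_left nhdsWithin_le_nhds
    obtain ⟨y, h1, h2⟩ := ((hlim.eventually (gt_mem_nhds hθ)).and
      (Ioo_mem_nhdsGT zero_lt_one)).exists
    exact ⟨y, h2.1, h1⟩
  refine ⟨4 * m * y₀ * a ^ 2 / c, by positivity, fun δ N h p p' hδ hδ₀ hh hp hp' => ?_⟩
  have hp0 : 0 < p := ha.trans_le hp.1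
  have hαp := hpos p
  have hp'0 : p' = -(c' / α p) := by field_simp; linarith
  set y := max 0 ((h - N) / δ) with hy
  have hy0 : 0 ≤ y := le_max_left _ _
  have hy1 : y < 1 := max_lt one_pos (by rw [div_lt_one hδ]; linarith)
  set g := 1 - y ^ 2 with hg
  have hg0 : 0 < g := by nlinarith
  have hg1 : g ≤ 1 := by nlinarith
  have hf : cutoff N δ h = g ^ 2 := by
    simp only [cutoff]; rw [← hy, ← hg, max_eq_right hg0.le]
  have hf' : cutoffDeriv N δ h = -(4 * g * y / δ) := by
    simp only [cutoffDeriv]; rw [← hy, ← hg, max_eq_right hg0.le]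
  rw [hf, hf']
  have hgg : g ^ 2 ≤ 1 := by nlinarith
  have hmem : g ^ 2 * p ∈ Icc 0 ξ := ⟨by positivity, by nlinarith [hp.2]⟩
  have hαm := hmle _ hmem
  have hα0 := hpos (g ^ 2 * p)
  rcases le_or_gt y y₀ with hyy | hyy
  · have hdist : dist p (g ^ 2 * p) < θ := by
      rw [Real.dist_eq, abs_of_nonneg (by nlinarith)]
      calc p - g ^ 2 * p = (1 - g ^ 2) * p := by ring
        _ ≤ (2 * y₀ ^ 2) * ξ := by
          refine mul_le_mul ?_ hp.2 hp0.le (by positivity)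
          have : y ^ 2 ≤ y₀ ^ 2 := by gcongr
          nlinarith [sq_nonneg (y ^ 2)]
        _ < θ := hy₀θ
    have hd := hθα p ⟨hp0.le, hp.2⟩ _ hmem hdist
    rw [Real.dist_eq] at hd
    have hd2 := (abs_lt.1 hd).2
    have hle : m * (c' - c) / c' ≤ α p * (c' - c) / c' := by
      have := hmle p ⟨hp0.le, hp.2⟩
      have : 0 ≤ c' - c := by linarith
      gcongr
    have hkey : c * α p ≤ α (g ^ 2 * p) * c' := by
      have : α p - α p * (c' - c) / c' = c * α p / c' := by field_simp; ring
      have : c * α p / c' ≤ α (g ^ 2 * p) := by linarith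
      rwa [div_le_iff₀ hc'] at this
    have h1 : -(4 * g * y / δ) * p ^ 2 ≤ 0 := by
      have : 0 ≤ 4 * g * y / δ * p ^ 2 := by positivity
      linarith
    have h2 : c ≤ α (g ^ 2 * p) * (c' / α p) := by
      rw [← mul_div_assoc, le_div_iff₀ hαp]; exact hkey
    calc α (g ^ 2 * p) * (-(4 * g * y / δ) * p ^ 2 + g ^ 2 * p')
        ≤ α (g ^ 2 * p) * (g ^ 2 * p') := by gcongr; linarith
      _ = -(α (g ^ 2 * p) * (c' / α p) * g ^ 2) := by rw [hp'0]; ring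
      _ ≤ -(c * g ^ 2) := by
        have := mul_le_mul_of_nonneg_right h2 (sq_nonneg g)
        linarith
  · have h1 : g ^ 2 * p' ≤ 0 := by
      rw [hp'0]
      have : 0 ≤ g ^ 2 * (c' / α p) := by positivity
      linarith
    have h2 : c * δ ≤ 4 * m * y₀ * a ^ 2 := by
      rw [le_div_iff₀ hc] at hδ₀; linarith
    have h3 : c ≤ α (g ^ 2 * p) * (4 * y / δ * p ^ 2) := by
      have : c ≤ m * (4 * y₀ / δ * a ^ 2) := by
        rw [show m * (4 * y₀ / δ * a ^ 2) = 4 * m * y₀ * a ^ 2 / δ by ring, le_div_iff₀ hδ]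
        exact h2
      refine this.trans ?_
      have := hp.1
      gcongr
    calc α (g ^ 2 * p) * (-(4 * g * y / δ) * p ^ 2 + g ^ 2 * p')
        ≤ α (g ^ 2 * p) * (-(4 * g * y / δ) * p ^ 2) := by gcongr; linarith
      _ = -(α (g ^ 2 * p) * (4 * y / δ * p ^ 2) * g) := by ring
      _ ≤ -(c * g) := by
        have := mul_le_mul_of_nonneg_right h3 hg0.le
        linarith
      _ ≤ -(c * g ^ 2) := by
        have : g ^ 2 ≤ g := by nlinarith
        nlinarith

/-- A positive decreasing slope profile solving `(A ∘ p)' = -c`, with `A' = α`, as long as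
`p ∈ [a, ξ]`. -/
lemma exists_slope_profile {α : ℝ → ℝ} (hα : Continuous α) (hpos : ∀ p, 0 < α p)
    {a ξ c : ℝ} (ha : 0 < a) (haξ : a < ξ) (hc : 0 < c) :
    ∃ (p p' : ℝ → ℝ) (x₁ : ℝ), 0 < x₁ ∧ Continuous p' ∧ (∀ x, HasDerivAt p (p' x) x) ∧
      (∀ x, 0 < p x) ∧ Antitone p ∧ p 0 = ξ ∧ p x₁ = a ∧
      ∀ x ∈ Icc 0 x₁, α (p x) * p' x = -c := by
  have hξ : 0 < ξ := ha.trans haξ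
  set k : ℝ → ℝ := fun r => max (log a) (min r (log ξ)) with hk
  have hlog : log a < log ξ := Real.log_lt_log ha haξ
  have hkmem : ∀ r, k r ∈ Icc (log a) (log ξ) := fun r =>
    ⟨le_max_left _ _, max_le hlog.le (min_le_right _ _)⟩
  have hkeq : ∀ r ∈ Icc (log a) (log ξ), k r = r := fun r hr => by
    simp only [hk]; rw [min_eq_left hr.2, max_eq_right hr.1]
  set β : ℝ → ℝ := fun r => α (exp (k r)) * exp (k r) with hβ
  have hβc : Continuous β := by simp only [hβ, hk]; fun_prop
  have hβpos : ∀ r, 0 < β r := fun r => mul_pos (hpos _) (exp_pos _)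
  obtain ⟨m, hm, hmβ⟩ : ∃ m > 0, ∀ r, m ≤ β r := by
    obtain ⟨q, -, hq⟩ := isCompact_Icc.exists_isMinOn (nonempty_Icc.2 hlog.le)
      (f := fun r => α (exp r) * exp r) (by fun_prop)
    exact ⟨_, mul_pos (hpos _) (exp_pos q), fun r => hq (hkmem r)⟩
  set D : ℝ → ℝ := fun r => ∫ s in (0 : ℝ)..r, β s with hD
  have hDd : ∀ r, HasDerivAt D (β r) r := fun r =>
    (hβc.integral_hasStrictDerivAt 0 r).hasDerivAt
  have hDmono : StrictMono D := strictMono_of_deriv_pos fun r => by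
    rw [(hDd r).deriv]; exact hβpos r
  have hD0 : D 0 = 0 := by simp [hD]
  have hDc : Continuous D := continuous_iff_continuousAt.2 fun r => (hDd r).continuousAt
  have hDm : Monotone fun r => D r - m * r := by
    have hd : ∀ r, HasDerivAt (fun r => D r - m * r) (β r - m) r := fun r => by
      simpa using (hDd r).fun_sub ((hasDerivAt_id r).const_mul m)
    refine monotone_of_deriv_nonneg (fun r => (hd r).differentiableAt) fun r => ?_
    rw [(hd r).deriv]
    linarith [hmβ r]
  have hDtop : Tendsto D atTop atTop := by
    refine tendsto_atTop_mono' atTop ?_ (tendsto_id.const_mul_atTop hm)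
    filter_upwards [eventually_ge_atTop 0] with r hr
    have := hDm hr
    simp only [hD0, mul_zero, sub_zero] at this
    simp only [id]; linarith
  have hDbot : Tendsto D atBot atBot := by
    refine tendsto_atBot_mono' atBot ?_ (tendsto_id.const_mul_atBot hm)
    filter_upwards [eventually_le_atBot 0] with r hr
    have := hDm hr
    simp only [hD0, mul_zero, sub_zero] at this
    simp only [id]; linarith
  set E := hDmono.orderIsoOfSurjective D (hDc.surjective hDtop hDbot) with hE
  have hED : ∀ r, E r = D r := fun r => rfl
  have hDE : ∀ v, D (E.symm v) = v := fun v => by rw [← hED]; exact E.apply_symm_apply v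
  have hEd : ∀ v, HasDerivAt E.symm (β (E.symm v))⁻¹ v := fun v =>
    HasDerivAt.of_local_left_inverse E.symm.continuous.continuousAt (hDd _) (hβpos _).ne'
      (Eventually.of_forall hDE)
  set R : ℝ → ℝ := fun x => E.symm (D (log ξ) - c * x) with hR
  have hRd : ∀ x, HasDerivAt R ((β (R x))⁻¹ * -c) x := fun x => by
    have h1 : HasDerivAt (fun x : ℝ => D (log ξ) - c * x) (-c) x := by
      simpa using ((hasDerivAt_id x).const_mul c).const_sub (D (log ξ))
    exact (hEd _).comp x h1
  have hRc : Continuous R := continuous_iff_continuousAt.2 fun x => (hRd x).continuousAt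
  have hRanti : Antitone R := fun x y hxy => E.symm.monotone (by nlinarith)
  have hR0 : R 0 = log ξ := by
    simp only [hR, mul_zero, sub_zero, ← hED]
    exact E.symm_apply_apply _
  set x₁ := (D (log ξ) - D (log a)) / c with hx₁
  have hR1 : R x₁ = log a := by
    have : D (log ξ) - c * x₁ = D (log a) := by rw [hx₁]; field_simp; ring
    simp only [hR]
    rw [this, ← hED]
    exact E.symm_apply_apply _
  refine ⟨fun x => exp (R x), fun x => exp (R x) * ((β (R x))⁻¹ * -c), x₁,
    div_pos (sub_pos.2 (hDmono hlog)) hc, ?_, fun x => (hRd x).exp, fun x => exp_pos _,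
    fun x y hxy => exp_le_exp.2 (hRanti hxy), ?_, ?_, ?_⟩
  · exact (continuous_exp.comp hRc).mul
      (((hβc.comp hRc).inv₀ fun x => (hβpos _).ne').mul continuous_const)
  · simp only [hR0, exp_log hξ]
  · simp only [hR1, exp_log ha]
  · intro x hx
    have hmem : R x ∈ Icc (log a) (log ξ) := by
      rw [← hR0, ← hR1]; exact ⟨hRanti hx.2, hRanti hx.1⟩
    have hβR : β (R x) = α (exp (R x)) * exp (R x) := by simp only [hβ, hkeq _ hmem]
    have := (hpos (exp (R x))).ne'
    have := (exp_pos (R x)).ne'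
    simp only [hβR]
    field_simp

/-- A bounded `C¹` clock which is linear up to time `t`. -/
lemma exists_clock {c t N : ℝ} (hc : 0 < c) (hN : c * t < N) :
    ∃ τ τ' : ℝ → ℝ, Continuous τ' ∧ (∀ s, HasDerivAt τ (τ' s) s) ∧ (∀ s, τ' s ∈ Icc 0 c) ∧
      (∀ s, τ s ≤ N) ∧ τ 0 ≤ 0 ∧ τ t = c * t := by
  set ρ := 2 * (N - c * t) / c with hρ
  have hρ0 : 0 < ρ := div_pos (by linarith) hc
  have hρN : c * t + c * ρ / 2 = N := by rw [hρ]; field_simp; ring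
  have hdiff : ∀ s, 0 ≤ max 0 (s - t) - max 0 (s - t - ρ) ∧
      max 0 (s - t) - max 0 (s - t - ρ) ≤ ρ := fun s => by
    rcases max_cases 0 (s - t) with ⟨h, h'⟩ | ⟨h, h'⟩ <;>
    rcases max_cases 0 (s - t - ρ) with ⟨k, k'⟩ | ⟨k, k'⟩ <;>
    rw [h, k] <;> constructor <;> linarith
  refine ⟨fun s => c * s - c / (2 * ρ) * ((max 0 (s - t)) ^ 2 - (max 0 (s - t - ρ)) ^ 2),
    fun s => c - c / ρ * (max 0 (s - t) - max 0 (s - t - ρ)), by fun_prop, fun s => ?_,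
    fun s => ⟨?_, ?_⟩, fun s => ?_, ?_, ?_⟩
  · have h1 := (hasDerivAt_max_zero_sq (s - t)).comp s ((hasDerivAt_id s).sub_const t)
    have h2 := (hasDerivAt_max_zero_sq (s - t - ρ)).comp s
      (((hasDerivAt_id s).sub_const t).sub_const ρ)
    refine (((hasDerivAt_id s).const_mul c).fun_sub
      ((h1.fun_sub h2).const_mul (c / (2 * ρ)))).congr_deriv ?_
    field_simp
  · have := mul_le_mul_of_nonneg_left (hdiff s).2 (div_pos hc hρ0).le
    rw [div_mul_cancel₀ _ hρ0.ne'] at this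
    linarith
  · have := mul_nonneg (div_pos hc hρ0).le (hdiff s).1
    linarith
  · have key : ∀ v, s - v / (2 * ρ) ≤ t + ρ / 2 →
        c * s - c / (2 * ρ) * v ≤ N := fun v hv => by
      have := mul_le_mul_of_nonneg_left hv hc.le
      rw [← hρN]
      calc c * s - c / (2 * ρ) * v = c * (s - v / (2 * ρ)) := by ring
        _ ≤ _ := by linarith
    refine key _ ?_
    rw [sub_le_iff_le_add, ← sub_le_iff_le_add', le_div_iff₀ (by positivity)]
    rcases max_cases 0 (s - t) with ⟨h, h'⟩ | ⟨h, h'⟩ <;>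
    rcases max_cases 0 (s - t - ρ) with ⟨k, k'⟩ | ⟨k, k'⟩ <;>
    rw [h, k] <;> nlinarith [sq_nonneg (s - t - ρ)]
  · have h0 := le_max_left 0 (0 - t - ρ)
    have h1 := (hdiff 0).1
    have : 0 ≤ c / (2 * ρ) * ((max 0 (0 - t)) ^ 2 - (max 0 (0 - t - ρ)) ^ 2) := by
      refine mul_nonneg (by positivity) ?_
      nlinarith
    simp only [mul_zero]
    linarith
  · simp [hρ0.le]

lemma memS_comp {α : ℝ → ℝ} {L M : ℝ} {F f f' W p p' τ τ' : ℝ → ℝ}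
    (hF : ∀ h, HasDerivAt F (f h) h) (hf : ∀ h, HasDerivAt f (f' h) h) (hf' : Continuous f')
    (hW : ∀ x, HasDerivAt W (p x) x) (hp : ∀ x, HasDerivAt p (p' x) x) (hp' : Continuous p')
    (hτ : ∀ s, HasDerivAt τ (τ' s) s) (hτ' : Continuous τ')
    (hnonneg : ∀ x s, 0 ≤ x → 0 ≤ s → 0 ≤ F (W x - τ s))
    (hinit : ∀ x, 0 < x → M ≤ F (W x - τ 0))
    (hsuper : ∀ x s, 0 < x → 0 < s → α (f (W x - τ s) * p x) *
      (f' (W x - τ s) * p x ^ 2 + f (W x - τ s) * p' x) ≤ -(τ' s * f (W x - τ s))) :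
    MemS α L (fun _ => M) (fun x s => F (W x - τ s)) := by
  have hFc : Continuous F := continuous_iff_continuousAt.2 fun x => (hF x).continuousAt
  have hfc : Continuous f := continuous_iff_continuousAt.2 fun x => (hf x).continuousAt
  have hWc : Continuous W := continuous_iff_continuousAt.2 fun x => (hW x).continuousAt
  have hpc : Continuous p := continuous_iff_continuousAt.2 fun x => (hp x).continuousAt
  have hτc : Continuous τ := continuous_iff_continuousAt.2 fun x => (hτ x).continuousAt
  have dX : ∀ x s, HasDerivAt (fun x => F (W x - τ s)) (f (W x - τ s) * p x) x := fun x s =>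
    (hF _).comp x ((hW x).sub_const (τ s))
  have eX : ∀ x s, pderivX (fun x s => F (W x - τ s)) x s = f (W x - τ s) * p x :=
    fun x s => (dX x s).deriv
  have dXX : ∀ x s, HasDerivAt (fun x => f (W x - τ s) * p x)
      (f' (W x - τ s) * p x ^ 2 + f (W x - τ s) * p' x) x := fun x s => by
    refine (((hf _).comp x ((hW x).sub_const (τ s))).fun_mul (hp x)).congr_deriv ?_
    simp only [Function.comp]
    ring
  have eXX : ∀ x s, pderivXX (fun x s => F (W x - τ s)) x s =
      f' (W x - τ s) * p x ^ 2 + f (W x - τ s) * p' x := fun x s => by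
    simp only [pderivXX, eX]
    exact (dXX x s).deriv
  have dT : ∀ x s, HasDerivAt (fun s => F (W x - τ s)) (-(τ' s * f (W x - τ s))) s :=
    fun x s => by
      refine ((hF _).comp s ((hτ s).const_sub (W x))).congr_deriv ?_
      ring
  have eT : ∀ x s, pderivT (fun x s => F (W x - τ s)) x s = -(τ' s * f (W x - τ s)) :=
    fun x s => (dT x s).deriv
  refine ⟨fun z t hz ht => hnonneg z t hz.1 ht, by fun_prop,
    ⟨by fun_prop, fun q _ => (dX q.1 q.2).differentiableAt, fun q _ => ?_,
      fun q _ => (dT q.1 q.2).differentiableAt, ?_, ?_, ?_⟩, fun z t hz ht => ?_,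
    fun z hz => hinit z hz.1⟩
  · simp only [eX]
    exact (dXX q.1 q.2).differentiableAt
  · simp only [eX]; fun_prop
  · simp only [eXX]; fun_prop
  · simp only [eT]; fun_prop
  · rw [eX, eXX, eT]
    exact hsuper z t hz.1 ht

/-- If `B(ξ) > M² / t`, a truncated travelling profile is a supersolution lying, at time `t`,
below a line of slope `ξ` up to an arbitrarily small error. -/
lemma exists_barrier {α : ℝ → ℝ} (hα : Continuous α) (hpos : ∀ p, 0 < α p) (L : ℝ)
    {M t ξ ε : ℝ} (hM : 0 < M) (ht : 0 < t) (hξ : 0 < ξ)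
    (hB : M ^ 2 / t < ∫ s in (0 : ℝ)..ξ, s * α s) (hε : 0 < ε) :
    ∃ φ, MemS α L (fun _ => M) φ ∧ ∀ z, 0 ≤ z → φ z t ≤ ξ * z + ε := by
  set g : ℝ → ℝ := fun s => s * α s with hg
  have hgc : Continuous g := by fun_prop
  set B : ℝ → ℝ := fun x => ∫ s in (0 : ℝ)..x, g s with hBdef
  have hBc : Continuous B := intervalIntegral.continuous_primitive
    (fun a b => hgc.intervalIntegrable a b) 0
  have hB0 : B 0 = 0 := by simp [hBdef]
  set c := M / t with hc
  have hc0 : 0 < c := by positivity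
  have hct : c * t = M := by rw [hc]; field_simp
  have hB' : c * M < B ξ := by
    have : M ^ 2 / t = c * M := by rw [hc]; ring
    rw [← this]; exact hB
  obtain ⟨N, hMN, hN⟩ : ∃ N, M < N ∧ N < min (M + ε) (B ξ / c) :=
    exists_between (lt_min (by linarith) (by rw [lt_div_iff₀ hc0]; linarith))
  have hN0 : 0 < N := hM.trans hMN
  have hNε : N < M + ε := hN.trans_le (min_le_left _ _)
  have hNB : c * N < B ξ := by
    have := hN.trans_le (min_le_right _ _)
    rw [lt_div_iff₀ hc0] at this; linarith
  obtain ⟨a, ⟨ha, haξ⟩, hBa⟩ : ∃ a ∈ Ioo 0 ξ, B a < B ξ - c * N := by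
    have hlim : Tendsto B (𝓝[>] 0) (𝓝 0) := by
      simpa [hB0] using (hBc.tendsto 0).mono_left nhdsWithin_le_nhds
    obtain ⟨a, h1, h2⟩ := ((hlim.eventually (gt_mem_nhds (sub_pos.2 hNB))).and
      (Ioo_mem_nhdsGT hξ)).exists
    exact ⟨a, h2, h1⟩
  obtain ⟨c', hcc', hc'⟩ : ∃ c', c < c' ∧ c' < (B ξ - B a) / N :=
    exists_between (by rw [lt_div_iff₀ hN0]; linarith)
  have hc'0 : 0 < c' := hc0.trans hcc'
  rw [lt_div_iff₀ hN0] at hc'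
  obtain ⟨δ₀, hδ₀, hcut⟩ := exists_cutoff_width hα hpos ha haξ hc0 hcc'
  obtain ⟨δ, hδ, hδle⟩ : ∃ δ > 0, δ ≤ min δ₀ ((B ξ - B a) / c' - N) :=
    ⟨_, lt_min hδ₀ (by rw [sub_pos, lt_div_iff₀ hc'0]; linarith), le_rfl⟩
  have hδ1 : δ ≤ δ₀ := hδle.trans (min_le_left _ _)
  have hδ2 : c' * (N + δ) ≤ B ξ - B a := by
    have := hδle.trans (min_le_right _ _)
    have : N + δ ≤ (B ξ - B a) / c' := by linarith
    rw [le_div_iff₀ hc'0] at this; linarith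
  obtain ⟨p, p', x₁, hx₁, hp'c, hp, hp0, hpanti, hpξ, hpa, hode⟩ :=
    exists_slope_profile hα hpos ha haξ hc'0
  obtain ⟨τ, τ', hτ'c, hτ, hτ', hτN, hτ0, hτt⟩ := exists_clock hc0 (hct.trans_lt hMN)
  have hpc : Continuous p := continuous_iff_continuousAt.2 fun x => (hp x).continuousAt
  set W : ℝ → ℝ := fun x => N + ∫ y in (0 : ℝ)..x, p y with hW
  have hWd : ∀ x, HasDerivAt W (p x) x := fun x =>
    (hpc.integral_hasStrictDerivAt 0 x).hasDerivAt.const_add N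
  have hWmono : StrictMono W := strictMono_of_deriv_pos fun x => by
    rw [(hWd x).deriv]; exact hp0 x
  have hW0 : W 0 = N := by simp [hW]
  have hWle : ∀ x, 0 ≤ x → W x ≤ N + ξ * x := fun x hx => by
    have : ∫ y in (0 : ℝ)..x, p y ≤ ∫ y in (0 : ℝ)..x, ξ :=
      intervalIntegral.integral_mono_on hx (hpc.intervalIntegrable _ _)
        intervalIntegrable_const fun y hy => hpξ ▸ hpanti hy.1
    simp only [intervalIntegral.integral_const, sub_zero, smul_eq_mul] at this
    simp only [hW]; linarith
  have hWx₁ : N + (N + δ) ≤ W x₁ := by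
    have h1 : ∫ x in (0 : ℝ)..x₁, (g ∘ p) x * p' x = ∫ u in p 0..p x₁, g u :=
      intervalIntegral.integral_comp_mul_deriv (fun x _ => hp x) hp'c.continuousOn hgc
    have h2 : ∫ x in (0 : ℝ)..x₁, (g ∘ p) x * p' x = ∫ x in (0 : ℝ)..x₁, -c' * p x := by
      refine intervalIntegral.integral_congr fun x hx => ?_
      rw [uIcc_of_le hx₁.le] at hx
      simp only [hg, Function.comp]
      rw [mul_assoc, hode x hx]; ring
    have h3 : ∫ u in ξ..a, g u = B a - B ξ :=
      (intervalIntegral.integral_interval_sub_left (hgc.intervalIntegrable _ _)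
        (hgc.intervalIntegrable _ _)).symm
    rw [h2, hpξ, hpa, h3, intervalIntegral.integral_const_mul] at h1
    have h4 : c' * (N + δ) ≤ c' * ∫ x in (0 : ℝ)..x₁, p x := by linarith
    have := le_of_mul_le_mul_left h4 hc'0
    simp only [hW]; linarith
  set F : ℝ → ℝ := fun h => ∫ u in (0 : ℝ)..h, cutoff N δ u with hF
  have hfc := continuous_cutoff N δ
  have hFd : ∀ h, HasDerivAt F (cutoff N δ h) h := fun h =>
    (hfc.integral_hasStrictDerivAt 0 h).hasDerivAt
  have hFmono : Monotone F := monotone_of_deriv_nonneg (fun h => (hFd h).differentiableAt)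
    fun h => by rw [(hFd h).deriv]; exact cutoff_nonneg _ _ _
  have hF0 : F 0 = 0 := by simp [hF]
  have hFle : ∀ h, 0 ≤ h → F h ≤ h := fun h hh => by
    have : F h ≤ ∫ u in (0 : ℝ)..h, (1 : ℝ) :=
      intervalIntegral.integral_mono_on hh (hfc.intervalIntegrable _ _)
        intervalIntegrable_const fun u _ => cutoff_le_one _ _ _
    simpa using this
  have hFN : F N = N := by
    have : F N = ∫ u in (0 : ℝ)..N, (1 : ℝ) :=
      intervalIntegral.integral_congr fun u hu => by
        rw [uIcc_of_le hN0.le] at hu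
        exact cutoff_of_le hδ hu.2
    simpa using this
  have hWN : ∀ x, 0 ≤ x → N ≤ W x := fun x hx => hW0 ▸ hWmono.monotone hx
  refine ⟨fun x s => F (W x - τ s), memS_comp hFd (hasDerivAt_cutoff N δ)
    (continuous_cutoffDeriv N δ) hWd hp hp'c hτ hτ'c ?_ ?_ ?_, ?_⟩
  · intro x s hx _
    rw [← hF0]
    exact hFmono (by linarith [hWN x hx, hτN s])
  · intro x hx
    calc M ≤ F N := by rw [hFN]; exact hMN.le
      _ ≤ F (W x - τ 0) := hFmono (by linarith [hWN x hx.le])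
  · intro x s hx _
    rcases le_or_gt (N + δ) (W x - τ s) with hh | hh
    · obtain ⟨h1, h2⟩ := cutoff_of_ge hδ hh
      simp [h1, h2]
    · have hxx : x < x₁ := hWmono.lt_iff_lt.1 (by linarith [hτN s])
      refine (hcut δ N _ (p x) (p' x) hδ hδ1 hh
        ⟨hpa ▸ hpanti hxx.le, hpξ ▸ hpanti hx.le⟩ (hode x ⟨hx.le, hxx.le⟩)).trans ?_
      exact neg_le_neg (mul_le_mul_of_nonneg_right (hτ' s).2 (cutoff_nonneg _ _ _))
  · intro z hz
    have h0 : 0 ≤ W z - τ t := by linarith [hWN z hz, hτN t]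
    refine (hFle _ h0).trans ?_
    rw [hτt, hct]
    linarith [hWle z hz]

/-! ### The gradient bound -/

lemma pderivX_psiPlus_le {α : ℝ → ℝ} (hα : Continuous α) (hpos : ∀ p, 0 < α p)
    {L M z t ξ : ℝ} (hM : 0 < M) (hz : z ∈ Ioo 0 (L / 2)) (ht : 0 < t) (hξ : 0 < ξ)
    (hB : M ^ 2 / t < ∫ s in (0 : ℝ)..ξ, s * α s) :
    pderivX (psiPlus α L fun _ => M) z t ≤ ξ := by
  set u := psiPlus α L fun _ => M with hu
  by_cases hd : DifferentiableAt ℝ (fun y => u y t) z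
  swap
  · simp only [pderivX]
    rw [deriv_zero_of_not_differentiableAt hd]; exact hξ.le
  have huz : u z t ≤ ξ * z := le_of_forall_pos_le_add fun ε hε => by
    obtain ⟨φ, hφ, hle⟩ := exists_barrier hα hpos L hM ht hξ hB hε
    exact (psiPlus_le hφ (Ioo_subset_Icc_self hz) ht.le).trans (hle z hz.1.le)
  have huz' : u z t / z ≤ ξ := by rw [div_le_iff₀ hz.1]; exact huz
  have hstar : ∀ y ∈ Ioo 0 z, u z t / z * y ≤ u y t := fun y hy => by
    obtain ⟨φ₀, hφ₀, -⟩ := exists_barrier hα hpos L hM ht hξ hB one_pos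
    refine le_csInf ⟨_, φ₀, hφ₀, rfl⟩ ?_
    rintro _ ⟨φ, hφ, rfl⟩
    exact psiPlus_mul_le hpos hM.le hφ hz ht hy
  have hlim : Tendsto (slope (fun y => u y t) z) (𝓝[<] z) (𝓝 (pderivX u z t)) :=
    hd.hasDerivAt.tendsto_slope.mono_left (nhdsWithin_mono _ fun y hy => ne_of_lt hy)
  refine le_of_tendsto hlim ?_
  filter_upwards [Ioo_mem_nhdsLT hz.1] with y hy
  refine le_trans ?_ huz'
  rw [slope_comm, slope_def_field, div_le_iff₀ (by linarith [hy.2])]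
  have h1 := hstar y hy
  have h2 : u z t / z * z = u z t := div_mul_cancel₀ _ hz.1.ne'
  linarith

lemma pderivX_psiPlus_le_sSup {α : ℝ → ℝ} (hα : Continuous α) (hpos : ∀ p, 0 < α p)
    {L M z t : ℝ} (hM : 0 < M)
    (hB : Tendsto (fun ξ => ∫ s in (0 : ℝ)..ξ, s * α s) atTop atTop)
    (hz : z ∈ Ioo 0 (L / 2)) (ht : 0 < t) :
    pderivX (psiPlus α L fun _ => M) z t ≤
      sSup {ξ : ℝ | (∫ s in (0 : ℝ)..ξ, s * α s) ≤ M ^ 2 / t} := by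
  set S := {ξ : ℝ | (∫ s in (0 : ℝ)..ξ, s * α s) ≤ M ^ 2 / t} with hS
  have hbdd : BddAbove S := by
    obtain ⟨b, hb⟩ := (eventually_atTop.1 (hB.eventually_gt_atTop (M ^ 2 / t)))
    exact ⟨b, fun ξ hξ => le_of_not_gt fun h => (hb ξ h.le).not_ge hξ⟩
  have h0 : (0 : ℝ) ≤ sSup S := le_csSup hbdd (by
    simp only [hS, mem_ofPred_eq, intervalIntegral.integral_same]; positivity)
  refine le_of_forall_gt_imp_ge_of_dense fun ξ hξ => ?_
  refine pderivX_psiPlus_le hα hpos hM hz ht (h0.trans_lt hξ) ?_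
  by_contra! h
  exact hξ.not_ge (le_csSup hbdd h)

lemma integral_mul_comp_neg (α : ℝ → ℝ) (ξ : ℝ) :
    ∫ s in (0 : ℝ)..ξ, s * α (-s) = ∫ s in (0 : ℝ)..(-ξ), s * α s := by
  have h := intervalIntegral.integral_comp_neg (a := 0) (b := ξ) fun s => s * α s
  simp only [neg_zero, neg_mul, intervalIntegral.integral_neg] at h
  rw [intervalIntegral.integral_symm (-ξ) 0, ← h, neg_neg]

end Supersolutions

theorem psiPlus_gradient_bound_constant_modulus
    (α : ℝ → ℝ) (hα : Continuous α) (hαpos : ∀ p, 0 < α p)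
    (L M : ℝ) (hL : 0 < L) (hM : 0 < M)
    (hBtop : Tendsto (fun ξ => ∫ s in (0:ℝ)..ξ, s * α s) atTop atTop)
    (hBbot : Tendsto (fun ξ => ∫ s in (0:ℝ)..ξ, s * α s) atBot atTop) :
    ∀ z ∈ Ioo (0:ℝ) (L/2), ∀ t : ℝ, 0 < t →
      sInf {ξ : ℝ | (∫ s in (0:ℝ)..ξ, s * α s) ≤ M^2 / t} ≤
          pderivX (psiPlus α L (fun _ => M)) z t ∧
        pderivX (psiPlus α L (fun _ => M)) z t ≤
          sSup {ξ : ℝ | (∫ s in (0:ℝ)..ξ, s * α s) ≤ M^2 / t} := by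
  intro z hz t ht
  refine ⟨?_, pderivX_psiPlus_le_sSup hα hαpos hM hBtop hz ht⟩
  set S := {ξ : ℝ | (∫ s in (0:ℝ)..ξ, s * α s) ≤ M ^ 2 / t} with hS
  have hz' : L / 2 - z ∈ Ioo 0 (L / 2) := ⟨by linarith [hz.2], by linarith [hz.1]⟩
  have htop : Tendsto (fun ξ => ∫ s in (0:ℝ)..ξ, s * α (-s)) atTop atTop := by
    simp only [integral_mul_comp_neg]
    exact hBbot.comp tendsto_neg_atTop_atBot
  have h := pderivX_psiPlus_le_sSup (hα.comp continuous_neg) (fun p => hαpos (-p)) hM htop hz' ht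
  have hset : {ξ : ℝ | (∫ s in (0:ℝ)..ξ, s * (α ∘ Neg.neg) s) ≤ M ^ 2 / t} = -S := by
    ext ξ
    simp only [Function.comp, hS, mem_ofPred_eq, Set.mem_neg, integral_mul_comp_neg]
  have hderiv : pderivX (psiPlus α L fun _ => M) z t =
      -pderivX (psiPlus (α ∘ Neg.neg) L fun _ => M) (L / 2 - z) t := by
    simp only [pderivX, psiPlus_reflect α]
    exact deriv_comp_const_sub
      (f := fun y => psiPlus (fun p => α (-p)) L (fun _ => M) y t) (L / 2) z
  rw [hset, Real.sSup_neg] at h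
  linarith
end

section
/- Let α : ℝ → ℝ be continuous and positive, L > 0, M > 0, and define A(ξ) = ∫₀^ξ α(s) ds and B(ξ) = ∫₀^ξ s α(s) ds. Suppose lim_{ξ→∞} B(ξ) < ∞ (so also lim_{ξ→∞} A(ξ) < ∞), and let ψ ≡ M be the constant modulus on (0,L/2). Then there exist τ̃ > 0 and X ∈ (0, L/4) such that the minimal supersolution satisfies ψ₊(x,t) ≥ M/4 for all 0 < x ≤ X and 0 < t ≤ τ̃. In particular ψ₊(·,t) does not tend to 0 at the left endpoint and hence admits no upper gradient bound, for 0 < t ≤ τ̃. -/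
open Set Real Filter

open Topology

/-- A function which is minimal at `x` from the right has nonnegative derivative there. -/
lemma HasDerivAt.nonneg_of_eventually_right {g : ℝ → ℝ} {g' x : ℝ} (hg : HasDerivAt g g' x)
    (h : ∀ᶠ y in 𝓝[>] x, g x ≤ g y) : 0 ≤ g' := by
  have h1 := (hasDerivWithinAt_iff_tendsto_slope' (s := Ioi x) (by simp)).1 hg.hasDerivWithinAt
  refine ge_of_tendsto h1 ?_
  filter_upwards [h, self_mem_nhdsWithin] with y hy hxy
  rw [slope_def_field]
  exact div_nonneg (sub_nonneg.2 hy) (sub_nonneg.2 (le_of_lt hxy))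

/-- A function which is minimal at `x` from the left has nonpositive derivative there. -/
lemma HasDerivAt.nonpos_of_eventually_left {g : ℝ → ℝ} {g' x : ℝ} (hg : HasDerivAt g g' x)
    (h : ∀ᶠ y in 𝓝[<] x, g x ≤ g y) : g' ≤ 0 := by
  have h1 := (hasDerivWithinAt_iff_tendsto_slope' (s := Iio x) (by simp)).1 hg.hasDerivWithinAt
  refine le_of_tendsto h1 ?_
  filter_upwards [h, self_mem_nhdsWithin] with y hy hxy
  rw [slope_def_field]
  exact div_nonpos_of_nonneg_of_nonpos (sub_nonneg.2 hy) (sub_nonpos.2 (le_of_lt hxy))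

/-- Second order necessary condition at a point where `f - V` has a local minimum. -/
lemma IsLocalMin.deriv_eq_and_le_deriv_deriv {f V p : ℝ → ℝ} {x p' : ℝ}
    (hmin : IsLocalMin (fun y => f y - V y) x)
    (hf : ∀ᶠ y in 𝓝 x, DifferentiableAt ℝ f y) (hf' : DifferentiableAt ℝ (deriv f) x)
    (hV : ∀ᶠ y in 𝓝 x, HasDerivAt V (p y) y) (hp : HasDerivAt p p' x) :
    deriv f x = p x ∧ p' ≤ deriv (deriv f) x := by
  have hd : ∀ᶠ y in 𝓝 x, HasDerivAt (fun y => V y - f y) (p y - deriv f y) y := by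
    filter_upwards [hf, hV] with y hy hy' using hy'.sub hy.hasDerivAt
  have h0 : p x - deriv f x = 0 := by
    have hm : IsLocalMax (fun y => V y - f y) x := by
      simpa using hmin.neg
    exact hm.hasDerivAt_eq_zero hd.self_of_nhds
  refine ⟨by linarith, ?_⟩
  by_contra! hlt
  have hderiv : deriv (fun y => V y - f y) =ᶠ[𝓝 x] fun y => p y - deriv f y := by
    filter_upwards [hd] with y hy using hy.deriv
  have hdd : deriv (deriv (fun y => V y - f y)) x = p' - deriv (deriv f) x := by
    rw [hderiv.deriv_eq]
    exact (hp.sub hf'.hasDerivAt).deriv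
  have hmin' : IsLocalMin (fun y => V y - f y) x :=
    isLocalMin_of_deriv_deriv_pos (by rw [hdd]; linarith)
      (by rw [hderiv.self_of_nhds]; exact h0) hd.self_of_nhds.continuousAt
  have hconst : (fun y => V y - f y) =ᶠ[𝓝 x] fun _ => V x - f x := by
    filter_upwards [hmin, hmin'] with y h1 h2
    linarith
  have : deriv (deriv (fun y => V y - f y)) x = 0 := by
    have h2 := hconst.deriv.deriv_eq
    simpa using h2
  linarith

/-- `V` is a viscosity subsolution of `α(V') V'' = -k` on `(0, b)`. -/
def IsViscositySub (α : ℝ → ℝ) (k b : ℝ) (V : ℝ → ℝ) : Prop :=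
  ∀ x ∈ Ioo 0 b, ∀ f : ℝ → ℝ, (∀ᶠ y in 𝓝 x, DifferentiableAt ℝ f y) →
    DifferentiableAt ℝ (deriv f) x → IsLocalMin (fun y => f y - V y) x →
    -k ≤ α (deriv f x) * deriv (deriv f) x

/-- Comparison of a supersolution with a profile `V` moving down at speed `k`. -/
lemma MemS.sub_mul_le {α : ℝ → ℝ} {L M : ℝ} {φ : ℝ → ℝ → ℝ} (hφ : MemS α L (fun _ => M) φ)
    {V : ℝ → ℝ} {k b T : ℝ} (hk : 0 ≤ k) (hbL : b < L / 2)
    (hVc : ContinuousOn V (Icc 0 b)) (hV0 : V 0 ≤ 0) (hVM : ∀ x ∈ Ioc 0 b, V x ≤ M)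
    (hVb : ∀ t ∈ Ioc 0 T, V b - k * t ≤ φ b t) (hV : IsViscositySub α k b V)
    {x t : ℝ} (hx : x ∈ Icc 0 b) (ht : t ∈ Icc 0 T) : V x - k * t ≤ φ x t := by
  obtain ⟨hnn, hcont, ⟨-, hdx, hdxx, hdt, -⟩, hsup, hini⟩ := hφ
  suffices H : ∀ δ > 0, 0 ≤ φ x t - V x + k * t + δ * (1 + t) by
    have hpos : (0:ℝ) < 1 + t := by linarith [ht.1]
    refine le_of_forall_pos_le_add fun δ hδ => ?_
    have := H (δ / (1 + t)) (by positivity)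
    rw [div_mul_cancel₀ _ hpos.ne'] at this
    linarith
  intro δ hδ
  by_contra! hneg
  set D : Set (ℝ × ℝ) := Icc 0 b ×ˢ Icc 0 T with hD
  have hDc : IsCompact D := isCompact_Icc.prod isCompact_Icc
  have hVD : ContinuousOn (fun q : ℝ × ℝ => V q.1) D :=
    hVc.comp continuousOn_fst fun q hq => hq.1
  set K : Set (ℝ × ℝ) := D ∩ (fun q : ℝ × ℝ => V q.1 - k * q.2 - δ * (1 + q.2)) ⁻¹' Ici 0 with hK
  have hKc : IsCompact K := by
    refine hDc.of_isClosed_subset ?_ inter_subset_left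
    refine ContinuousOn.preimage_isClosed_of_isClosed ?_ hDc.isClosed isClosed_Ici
    exact (hVD.sub (by fun_prop)).sub (by fun_prop)
  have hKx : ∀ q ∈ K, 0 < q.1 := by
    rintro ⟨y, s⟩ ⟨⟨hy, hs⟩, hq⟩
    simp only [mem_preimage, mem_Ici, mem_Icc] at hq hy hs ⊢
    rcases hy.1.lt_or_eq with h | h
    · exact h
    · subst h
      have h1 : 0 ≤ k * s := mul_nonneg hk hs.1
      have h2 : 0 < δ * (1 + s) := mul_pos hδ (by linarith)
      linarith
  have hmem : ∀ q ∈ D, φ q.1 q.2 - V q.1 + k * q.2 + δ * (1 + q.2) < 0 → q ∈ K := by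
    rintro ⟨y, s⟩ ⟨hy, hs⟩ hq
    refine ⟨⟨hy, hs⟩, ?_⟩
    simp only [mem_preimage, mem_Ici] at hq hy hs ⊢
    have := hnn y s ⟨hy.1, hy.2.trans hbL.le⟩ hs.1
    linarith
  have hFc : ContinuousOn
      (fun q : ℝ × ℝ => φ q.1 q.2 - V q.1 + k * q.2 + δ * (1 + q.2)) K := by
    have h1 : ContinuousOn (fun q : ℝ × ℝ => φ q.1 q.2) K := by
      refine hcont.mono fun q hq => ⟨⟨⟨hq.1.1.1, hq.1.1.2.trans hbL.le⟩, hq.1.2.1⟩, ?_⟩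
      have h0 := hKx q hq
      have hb := hq.1.1.2
      rintro (h | h)
      · rw [h] at h0; exact lt_irrefl _ h0
      · rw [h] at hb; exact absurd hb (not_le.2 hbL)
    have h2 : ContinuousOn (fun q : ℝ × ℝ => V q.1) K := hVD.mono inter_subset_left
    exact ((h1.sub h2).add (by fun_prop)).add (by fun_prop)
  have hxt : (x, t) ∈ K := hmem (x, t) ⟨hx, ht⟩ hneg
  obtain ⟨⟨x₀, t₀⟩, hq₀, hmin⟩ := hKc.exists_isMinOn ⟨_, hxt⟩ hFc
  have hF₀ : φ x₀ t₀ - V x₀ + k * t₀ + δ * (1 + t₀) < 0 := lt_of_le_of_lt (hmin hxt) hneg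
  have hminD : ∀ y ∈ Icc 0 b, ∀ s ∈ Icc 0 T,
      φ x₀ t₀ - V x₀ + k * t₀ + δ * (1 + t₀) ≤ φ y s - V y + k * s + δ * (1 + s) := by
    intro y hy s hs
    by_contra! hlt
    exact absurd (hmin (hmem (y, s) ⟨hy, hs⟩ (hlt.trans hF₀))) (not_le.2 hlt)
  have hx₀ : 0 < x₀ := hKx _ hq₀
  obtain ⟨⟨⟨-, hx₀b⟩, ht₀, ht₀T⟩, -⟩ := hq₀
  simp only at hx₀b ht₀ ht₀T
  have hδt : 0 < δ * (1 + t₀) := mul_pos hδ (by linarith)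
  have ht₀pos : 0 < t₀ := by
    rcases ht₀.lt_or_eq with h | h
    · exact h
    · subst h
      have h1 := hini x₀ ⟨hx₀, hx₀b.trans_lt hbL⟩
      have h2 := hVM x₀ ⟨hx₀, hx₀b⟩
      simp only at h1
      linarith
  have hx₀lt : x₀ < b := by
    rcases hx₀b.lt_or_eq with h | h
    · exact h
    · subst h
      have := hVb t₀ ⟨ht₀pos, ht₀T⟩
      linarith
  have hmemS : (x₀, t₀) ∈ Ioo 0 (L / 2) ×ˢ Ioi (0:ℝ) := ⟨⟨hx₀, hx₀lt.trans hbL⟩, ht₀pos⟩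
  have htime : pderivT φ x₀ t₀ + k + δ ≤ 0 := by
    have h1 : HasDerivAt (fun s => φ x₀ s - V x₀ + k * s + δ * (1 + s))
        (pderivT φ x₀ t₀ + k + δ) t₀ := by
      have h2 : HasDerivAt (fun s => φ x₀ s) (pderivT φ x₀ t₀) t₀ := (hdt _ hmemS).hasDerivAt
      have h3 := ((h2.sub_const (V x₀)).add ((hasDerivAt_id t₀).const_mul k)).add
        (((hasDerivAt_id t₀).const_add 1).const_mul δ)
      exact h3.congr_deriv (by simp)
    refine h1.nonpos_of_eventually_left ?_
    filter_upwards [Ioo_mem_nhdsLT ht₀pos] with s hs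
    exact hminD x₀ ⟨hx₀.le, hx₀lt.le⟩ s ⟨hs.1.le, hs.2.le.trans ht₀T⟩
  have hspace : -k ≤ α (pderivX φ x₀ t₀) * pderivXX φ x₀ t₀ := by
    refine hV x₀ ⟨hx₀, hx₀lt⟩ (fun y => φ y t₀) ?_ (hdxx _ hmemS) ?_
    · filter_upwards [Ioo_mem_nhds hx₀ (hx₀lt.trans hbL)] with y hy
      exact hdx (y, t₀) ⟨hy, ht₀pos⟩
    · filter_upwards [Ioo_mem_nhds hx₀ hx₀lt] with y hy
      have := hminD y ⟨hy.1.le, hy.2.le⟩ t₀ ⟨ht₀, ht₀T⟩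
      linarith
  have := hsup x₀ t₀ hmemS.1 ht₀pos
  linarith

/-- A supersolution starting above `M` stays above `M - k t` at `x = r`, with `k` independent of
the supersolution. -/
lemma MemS.exists_forall_sub_mul_le {α : ℝ → ℝ} (hα : Continuous α) (hαpos : ∀ p, 0 < α p)
    {L M r : ℝ} (hM : 0 < M) (hr : 0 < r) (hrL : 2 * r < L / 2) :
    ∃ k > 0, ∀ φ, MemS α L (fun _ => M) φ → ∀ t, 0 ≤ t → M - k * t ≤ φ r t := by
  set q : ℝ := M / r ^ 2 with hq
  have hqpos : 0 < q := by positivity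
  have hqr : q * r ^ 2 = M := by rw [hq]; field_simp
  obtain ⟨c, hc⟩ := (isCompact_Icc (a := -(2 * q * r)) (b := 2 * q * r)).bddAbove_image
    hα.continuousOn
  have hcα : ∀ s ∈ Icc (-(2 * q * r)) (2 * q * r), α s ≤ c := fun s hs =>
    hc (mem_image_of_mem α hs)
  have hcpos : 0 < c := (hαpos 0).trans_le (hcα 0 ⟨by simp; positivity, by positivity⟩)
  refine ⟨2 * q * c, by positivity, fun φ hφ t ht => ?_⟩
  have hsub : IsViscositySub α (2 * q * c) (2 * r) (fun x => M - q * (x - r) ^ 2) := by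
    intro x hx f hf hf' hmin
    obtain ⟨h1, h2⟩ := hmin.deriv_eq_and_le_deriv_deriv (p := fun y => -(2 * q * (y - r)))
      (p' := -(2 * q)) hf hf'
      (Eventually.of_forall fun y => by
        have := ((((hasDerivAt_id y).sub_const r).pow 2).const_mul q).const_sub M
        refine this.congr_deriv ?_
        simp; ring)
      (by
        have := (((hasDerivAt_id x).sub_const r).const_mul (2 * q)).neg
        refine this.congr_deriv ?_
        simp)
    have h3 : α (deriv f x) ≤ c := by
      rw [h1]
      have : 0 < 2 * q := by positivity
      exact hcα _ ⟨by nlinarith [hx.1, hx.2], by nlinarith [hx.1, hx.2]⟩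
    have h4 := hαpos (deriv f x)
    nlinarith
  have := hφ.sub_mul_le (T := t) (k := 2 * q * c) (b := 2 * r) (x := r) (t := t)
    (V := fun x => M - q * (x - r) ^ 2) (by positivity) hrL (by fun_prop) (by nlinarith)
    (fun x _ => by nlinarith [mul_nonneg hqpos.le (sq_nonneg (x - r))]) (fun s hs => by
      have h1 := hφ.1 (2 * r) s ⟨by linarith, hrL.le⟩ hs.1.le
      have h2 : 0 ≤ 2 * q * c * s := mul_nonneg (by positivity) hs.1.le
      nlinarith) hsub ⟨hr.le, by linarith⟩ ⟨ht, le_rfl⟩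
  simpa using this

/-- The primitive of a continuous positive function has a differentiable left inverse. -/
lemma exists_leftInverse_integral {α : ℝ → ℝ} (hα : Continuous α) (hαpos : ∀ p, 0 < α p) :
    ∃ P : ℝ → ℝ, (∀ s, P (∫ u in (0:ℝ)..s, α u) = s) ∧
      ∀ s, HasDerivAt P (α s)⁻¹ (∫ u in (0:ℝ)..s, α u) := by
  have hd : ∀ s, HasStrictDerivAt (fun s => ∫ u in (0:ℝ)..s, α u) (α s) s := fun s =>
    hα.integral_hasStrictDerivAt 0 s
  have hmono : StrictMono (fun s => ∫ u in (0:ℝ)..s, α u) :=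
    strictMono_of_deriv_pos fun s => by rw [(hd s).hasDerivAt.deriv]; exact hαpos s
  have hinv := Function.leftInverse_invFun hmono.injective
  exact ⟨_, hinv, fun s => ((hd s).to_local_left_inverse (hαpos s).ne'
    (Eventually.of_forall hinv)).hasDerivAt⟩

/-- A steep profile: it rises linearly from `0` to `m` on `[0, ε]` and then bends down from
slope `S` with `α(V') V'' = -k`, where `k = r⁻¹ ∫₀¹ α`, while rising at most `C / k`. -/
lemma exists_steep_viscositySub {α : ℝ → ℝ} (hα : Continuous α) (hαpos : ∀ p, 0 < α p)
    {r m C k ε S : ℝ} (hk : 0 < k) (hkr : k * r = ∫ u in (0:ℝ)..1, α u)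
    (hC : ∀ s, 0 ≤ s → ∫ u in (0:ℝ)..s, u * α u ≤ C)
    (hS : 1 < S) (hε : 0 < ε) (hεr : ε < r) (hSε : (S - 1) * ε = m) :
    ∃ V : ℝ → ℝ, ContinuousOn V (Icc 0 r) ∧ V 0 = 0 ∧ (∀ x ∈ Icc 0 r, V x ≤ m + C / k) ∧
      (∀ x ∈ Icc ε r, m ≤ V x) ∧ IsViscositySub α k r V := by
  obtain ⟨P, hP, hP'⟩ := exists_leftInverse_integral hα hαpos
  set A : ℝ → ℝ := fun s => ∫ u in (0:ℝ)..s, α u with hA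
  set B : ℝ → ℝ := fun s => ∫ u in (0:ℝ)..s, u * α u with hB
  have hAd : ∀ s, HasDerivAt A (α s) s := fun s => (hα.integral_hasStrictDerivAt 0 s).hasDerivAt
  have hBd : ∀ s, HasDerivAt B (s * α s) s := fun s =>
    ((continuous_id.mul hα).integral_hasStrictDerivAt 0 s).hasDerivAt
  have hAmono : StrictMono A :=
    strictMono_of_deriv_pos fun s => by rw [(hAd s).deriv]; exact hαpos s
  have hAc : Continuous A := continuous_iff_continuousAt.2 fun s => (hAd s).continuousAt
  have hA0 : A 0 = 0 := by simp [hA]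
  have hB0 : B 0 = 0 := by simp [hB]
  have hBmono : MonotoneOn B (Ici 0) := by
    refine monotoneOn_of_deriv_nonneg (convex_Ici 0)
      (fun s _ => (hBd s).continuousAt.continuousWithinAt)
      (fun s _ => (hBd s).differentiableAt.differentiableWithinAt) fun s hs => ?_
    rw [(hBd s).deriv]
    rw [interior_Ici] at hs
    exact mul_nonneg (le_of_lt hs) (hαpos s).le
  have hCpos : 0 ≤ C := by simpa using hC 0 le_rfl
  set y : ℝ → ℝ := fun x => A S - k * (x - ε) with hy
  have hyd : ∀ x, HasDerivAt y (-k) x := fun x => by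
    have := (((hasDerivAt_id x).sub_const ε).const_mul k).const_sub (A S)
    simpa using this
  have hrange : ∀ x ∈ Icc ε r, ∃ s ∈ Icc 0 S, A s = y x := by
    intro x hx
    refine intermediate_value_Icc (by linarith) hAc.continuousOn ⟨?_, ?_⟩
    · have h1 : A 1 < A S := hAmono hS
      have h2 : k * r = A 1 := hkr
      have h3 : k * (x - ε) ≤ k * r := mul_le_mul_of_nonneg_left (by linarith [hx.2]) hk.le
      simp only [hA0, hy]
      linarith
    · have : 0 ≤ k * (x - ε) := mul_nonneg hk.le (by linarith [hx.1])
      simp only [hy]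
      linarith
  have hpd : ∀ x ∈ Icc ε r,
      HasDerivAt (fun x => P (y x)) ((α (P (y x)))⁻¹ * -k) x := by
    intro x hx
    obtain ⟨s, -, hs⟩ := hrange x hx
    have h1 := hP' s
    have h2 : P (y x) = s := by rw [← hs]; exact hP s
    rw [h2]
    change HasDerivAt P _ (A s) at h1
    rw [hs] at h1
    exact h1.comp x (hyd x)
  set W : ℝ → ℝ := fun x => m + (B S - B (P (y x))) / k with hW
  have hWd : ∀ x ∈ Icc ε r, HasDerivAt W (P (y x)) x := by
    intro x hx
    have h1 := ((((hBd (P (y x))).comp x (hpd x hx)).const_sub (B S)).div_const k).const_add m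
    refine h1.congr_deriv ?_
    have := (hαpos (P (y x))).ne'
    field_simp
  have hyε : P (y ε) = S := by
    have : y ε = A S := by simp [hy]
    rw [this]; exact hP S
  have hWε : W ε = m := by simp [hW, hyε]
  have hWbd : ∀ x ∈ Icc ε r, m ≤ W x ∧ W x ≤ m + C / k := by
    intro x hx
    obtain ⟨s, hs, hsy⟩ := hrange x hx
    have h2 : P (y x) = s := by rw [← hsy]; exact hP s
    simp only [hW, h2]
    have h3 : B s ≤ B S := hBmono hs.1 (mem_Ici.2 (by linarith)) hs.2
    have h4 : 0 ≤ B s := hB0 ▸ hBmono (mem_Ici.2 le_rfl) hs.1 hs.1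
    have h5 : B S ≤ C := hC S (by linarith)
    constructor
    · have := div_nonneg (sub_nonneg.2 h3) hk.le
      linarith
    · have : (B S - B s) / k ≤ C / k := by gcongr; linarith
      linarith
  set V : ℝ → ℝ := fun x => if x ≤ ε then (S - 1) * x else W x with hV
  have hVl : ∀ x, x ≤ ε → V x = (S - 1) * x := fun x hx => by simp [hV, hx]
  have hVr : ∀ x, ε ≤ x → V x = W x := fun x hx => by
    rcases hx.lt_or_eq with h | h
    · simp [hV, not_le.2 h]
    · subst h; rw [hVl _ le_rfl, hWε, hSε]
  refine ⟨V, ?_, by simp [hVl 0 hε.le], ?_, ?_, ?_⟩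
  · rw [← Icc_union_Icc_eq_Icc hε.le hεr.le]
    refine ContinuousOn.union_of_isClosed ?_ ?_ isClosed_Icc isClosed_Icc
    · exact ContinuousOn.congr (f := fun x => (S - 1) * x) (by fun_prop) fun x hx => hVl x hx.2
    · exact ContinuousOn.congr (f := W)
        (fun x hx => (hWd x hx).continuousAt.continuousWithinAt) fun x hx => hVr x hx.1
  · intro x hx
    rcases le_total x ε with h | h
    · rw [hVl x h]
      have h1 : (S - 1) * x ≤ (S - 1) * ε := mul_le_mul_of_nonneg_left h (by linarith)
      have h2 : 0 ≤ C / k := div_nonneg hCpos hk.le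
      linarith
    · rw [hVr x h]; exact (hWbd x ⟨h, hx.2⟩).2
  · intro x hx
    rw [hVr x hx.1]; exact (hWbd x hx).1
  · intro x hx f hf hf' hmin
    rcases lt_trichotomy x ε with h | h | h
    · obtain ⟨-, h2⟩ := hmin.deriv_eq_and_le_deriv_deriv (p := fun _ => S - 1) (p' := 0) hf hf'
        (by
          filter_upwards [isOpen_Iio.eventually_mem h] with z hz
          have h1 : HasDerivAt (fun x => (S - 1) * x) (S - 1) z := by
            simpa using (hasDerivAt_id z).const_mul (S - 1)
          refine h1.congr_of_eventuallyEq ?_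
          filter_upwards [isOpen_Iio.eventually_mem hz] with w hw using hVl w (le_of_lt hw))
        (hasDerivAt_const _ _)
      have := mul_nonneg (hαpos (deriv f x)).le h2
      linarith
    · subst h
      exfalso
      have hfx := hf.self_of_nhds.hasDerivAt
      have h1 : deriv f x - (S - 1) ≤ 0 := by
        have hd : HasDerivAt (fun z => f z - (S - 1) * z) (deriv f x - (S - 1)) x := by
          exact (hfx.sub ((hasDerivAt_id x).const_mul (S - 1))).congr_deriv (by simp)
        refine hd.nonpos_of_eventually_left ?_
        filter_upwards [hmin.filter_mono nhdsWithin_le_nhds, self_mem_nhdsWithin] with z hz hzx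
        rw [hVl x le_rfl, hVl z (le_of_lt hzx)] at hz
        exact hz
      have h2 : 0 ≤ deriv f x - S := by
        have hd : HasDerivAt (fun z => f z - W z) (deriv f x - S) x := by
          have := hWd x ⟨le_rfl, hεr.le⟩
          rw [hyε] at this
          exact hfx.sub this
        refine hd.nonneg_of_eventually_right ?_
        filter_upwards [hmin.filter_mono nhdsWithin_le_nhds, self_mem_nhdsWithin] with z hz hzx
        rw [hVr x le_rfl, hVr z (le_of_lt hzx)] at hz
        exact hz
      linarith
    · obtain ⟨h1, h2⟩ := hmin.deriv_eq_and_le_deriv_deriv (p := fun z => P (y z)) hf hf'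
        (by
          filter_upwards [Ioo_mem_nhds h hx.2] with z hz
          refine (hWd z ⟨hz.1.le, hz.2.le⟩).congr_of_eventuallyEq ?_
          filter_upwards [isOpen_Ioi.eventually_mem hz.1] with w hw using hVr w (le_of_lt hw))
        (hpd x ⟨h.le, hx.2.le⟩)
      have h3 := mul_le_mul_of_nonneg_left h2 (hαpos (P (y x))).le
      rw [h1]
      rw [← mul_assoc, mul_inv_cancel₀ (hαpos _).ne', one_mul] at h3
      exact h3

/-- The constant `M` belongs to the class of supersolutions above `M`. -/
lemma memS_const (α : ℝ → ℝ) (L : ℝ) {M : ℝ} (hM : 0 ≤ M) :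
    MemS α L (fun _ => M) (fun _ _ => M) := by
  have h1 : ∀ x t, pderivX (fun _ _ => M) x t = 0 := fun x t => by simp [pderivX]
  have h2 : ∀ x t, pderivXX (fun _ _ => M) x t = 0 := fun x t => by simp [pderivXX, h1]
  have h3 : ∀ x t, pderivT (fun _ _ => M) x t = 0 := fun x t => by simp [pderivT]
  refine ⟨fun _ _ _ _ => hM, continuousOn_const, ⟨continuousOn_const, ?_, ?_, ?_, ?_, ?_, ?_⟩,
    ?_, fun _ _ => le_rfl⟩ <;> simp [h1, h2, h3, continuousOn_const]

theorem psiPlus_no_gradient_bound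
    (α : ℝ → ℝ) (hα : Continuous α) (hαpos : ∀ p, 0 < α p)
    (L M : ℝ) (hL : 0 < L) (hM : 0 < M)
    (hBfin : ∃ C : ℝ, Tendsto (fun ξ => ∫ s in (0:ℝ)..ξ, s * α s) atTop (nhds C)) :
    ∃ τ : ℝ, 0 < τ ∧ ∃ X ∈ Ioo (0:ℝ) (L/4),
      ∀ x t : ℝ, 0 < x → x ≤ X → 0 < t → t ≤ τ →
        M / 4 ≤ psiPlus α L (fun _ => M) x t := by
  obtain ⟨C, hC⟩ := hBfin
  have hCle : ∀ s, 0 ≤ s → ∫ u in (0:ℝ)..s, u * α u ≤ C := by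
    intro s hs
    refine ge_of_tendsto hC ?_
    filter_upwards [eventually_ge_atTop s] with v hv
    have hint : ∀ a b : ℝ, IntervalIntegrable (fun u => u * α u) MeasureTheory.volume a b :=
      fun a b => (continuous_id.mul hα).intervalIntegrable a b
    rw [← intervalIntegral.integral_add_adjacent_intervals (hint 0 s) (hint s v)]
    have : 0 ≤ ∫ u in s..v, u * α u :=
      intervalIntegral.integral_nonneg hv fun u hu => mul_nonneg (hs.trans hu.1) (hαpos u).le
    linarith
  have hC0 : 0 ≤ C := by simpa using hCle 0 le_rfl
  set a : ℝ := ∫ u in (0:ℝ)..1, α u with ha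
  have hapos : 0 < a :=
    intervalIntegral.intervalIntegral_pos_of_pos (hα.intervalIntegrable 0 1) hαpos one_pos
  set r : ℝ := min (L / 8) (M * a / (4 * (C + 1))) with hr
  have hrpos : 0 < r := by rw [hr]; positivity
  have hrL : r ≤ L / 8 := min_le_left _ _
  have hrC : C / (a / r) ≤ M / 4 := by
    have h1 : r ≤ M * a / (4 * (C + 1)) := min_le_right _ _
    rw [le_div_iff₀ (by positivity)] at h1
    rw [div_div_eq_mul_div, div_le_iff₀ hapos]
    nlinarith
  obtain ⟨k₁, hk₁, hbump⟩ := MemS.exists_forall_sub_mul_le hα hαpos (L := L) hM hrpos (by linarith)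
  set k : ℝ := a / r with hk
  have hkpos : 0 < k := by positivity
  refine ⟨min (M / (4 * k₁)) (M / (4 * k)), by positivity, r, ⟨hrpos, by linarith⟩, ?_⟩
  intro x t hx hxr ht htτ
  refine le_csInf ⟨M, fun _ _ => M, memS_const α L hM.le, rfl⟩ ?_
  rintro _ ⟨φ, hφ, rfl⟩
  have hbound : ∀ s, s ≤ min (M / (4 * k₁)) (M / (4 * k)) → k₁ * s ≤ M / 4 ∧ k * s ≤ M / 4 := by
    intro s hs
    have h1 := hs.trans (min_le_left _ _)
    have h2 := hs.trans (min_le_right _ _)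
    rw [le_div_iff₀ (by positivity)] at h1 h2
    constructor <;> linarith
  set ε : ℝ := x / 2 with hε
  have hεpos : 0 < ε := by positivity
  obtain ⟨V, hVc, hV0, hVle, hVge, hVsub⟩ := exists_steep_viscositySub hα hαpos (r := r)
    (m := M / 2) (C := C) (k := k) (ε := ε) (S := 1 + M / 2 / ε) hkpos
    (by rw [hk, div_mul_cancel₀ _ hrpos.ne']) hCle (by linarith [show 0 < M / 2 / ε by positivity]) hεpos
    (by linarith) (by field_simp; ring)
  have hmain := hφ.sub_mul_le (T := t) hkpos.le (by linarith) hVc hV0.le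
    (fun z hz => by linarith [hVle z ⟨hz.1.le, hz.2⟩]) (fun s hs => by
      have h1 := hbump φ hφ s hs.1.le
      have h2 := (hbound s (hs.2.trans htτ)).1
      have h3 := hVle r ⟨hrpos.le, le_rfl⟩
      have h4 := mul_pos hkpos hs.1
      linarith) hVsub ⟨hx.le, hxr⟩ ⟨ht.le, le_rfl⟩
  have h1 := hVge x ⟨by linarith, hxr⟩
  have h2 := (hbound t htτ).2
  linarith
end

section
/- Let α : ℝ → ℝ be continuous and positive, L > 0, and let ã = ã(x,t,z,p) be continuous, L-periodic in x, and satisfy ã(x,t,z,p) ≥ α(p) for all (x,t,z,p). Let u be a regular L-periodic solution of ∂_t u(x,t) = ã(x, t, u(x,t), ∂_x u(x,t)) ∂²_x u(x,t) on ℝ × [0,T], and let ψ be positive and concave on (0,L/2) and a modulus of continuity for u(·,0). Then for each t ∈ (0,T], the minimal supersolution ψ₊(·,t) (defined using supersolutions of ∂_t φ ≥ α(∂_x φ) ∂²_x φ) is a modulus of continuity for u(·,t). -/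
open Set Real Filter

open Topology

/-- A one-sided comparison of difference quotients forces the derivative to be nonnegative. -/
lemma HasDerivAt.nonneg_of_frequently_slope_nonneg {f : ℝ → ℝ} {f' a : ℝ} (hf : HasDerivAt f f' a)
    (h : ∃ᶠ x in 𝓝[≠] a, 0 ≤ slope f a x) : 0 ≤ f' := by
  by_contra hneg
  have h1 := (hasDerivAt_iff_tendsto_slope.1 hf).eventually_lt_const (not_le.1 hneg)
  obtain ⟨x, hx, hx'⟩ := (h.and_eventually h1).exists
  exact absurd hx (not_le.2 hx')

lemma HasDerivAt.nonneg_of_le_right {f : ℝ → ℝ} {f' a b : ℝ} (hf : HasDerivAt f f' a)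
    (hab : a < b) (h : ∀ x ∈ Ioo a b, f a ≤ f x) : 0 ≤ f' := by
  refine hf.nonneg_of_frequently_slope_nonneg ?_
  have h1 : ∀ᶠ x in 𝓝[>] a, 0 ≤ slope f a x := by
    filter_upwards [Ioo_mem_nhdsGT hab] with x hx
    rw [slope_def_field]
    exact div_nonneg (sub_nonneg.2 (h x hx)) (sub_nonneg.2 hx.1.le)
  exact h1.frequently.filter_mono (nhdsWithin_mono _ fun x hx => ne_of_gt hx)

lemma HasDerivAt.nonneg_of_le_left {f : ℝ → ℝ} {f' a b : ℝ} (hf : HasDerivAt f f' b)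
    (hab : a < b) (h : ∀ x ∈ Ioo a b, f x ≤ f b) : 0 ≤ f' := by
  refine hf.nonneg_of_frequently_slope_nonneg ?_
  have h1 : ∀ᶠ x in 𝓝[<] b, 0 ≤ slope f b x := by
    filter_upwards [Ioo_mem_nhdsLT hab] with x hx
    rw [slope_def_field]
    exact div_nonneg_of_nonpos (sub_nonpos.2 (h x hx)) (sub_nonpos.2 hx.2.le)
  exact h1.frequently.filter_mono (nhdsWithin_mono _ fun x hx => ne_of_lt hx)

/-- Second derivative test: the second derivative is nonpositive at a local maximum. -/
lemma IsLocalMax.second_deriv_nonpos {f f' : ℝ → ℝ} {f'' a : ℝ} (h : IsLocalMax f a)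
    (hf : ∀ᶠ x in 𝓝 a, HasDerivAt f (f' x) x) (hf' : HasDerivAt f' f'' a) : f'' ≤ 0 := by
  by_contra! hpos
  have heq : deriv f =ᶠ[𝓝 a] f' := hf.mono fun x hx => hx.deriv
  have hdd : deriv (deriv f) a = f'' := by rw [heq.deriv_eq, hf'.deriv]
  have hmin : IsLocalMin f a := isLocalMin_of_deriv_deriv_pos (by rwa [hdd]) h.deriv_eq_zero
    hf.self_of_nhds.continuousAt
  have hconst : f =ᶠ[𝓝 a] fun _ => f a := by
    filter_upwards [h, hmin] with x h1 h2 using le_antisymm h1 h2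
  have h0 : deriv (deriv f) a = 0 := by
    rw [hconst.deriv.deriv_eq]
    simp
  linarith

lemma hasDerivAt_convexComb (a b m : ℝ) :
    HasDerivAt (fun m : ℝ => m * a + (1 - m) * b) (a - b) m :=
  (((hasDerivAt_id m).mul_const a).add (((hasDerivAt_id m).const_sub 1).mul_const b)).congr_deriv
    (by ring)

/-- All chords between points of `K` lie below the graph of `Φ`. -/
def ChordsBelow (K : Set (ℝ × ℝ)) (Φ : ℝ → ℝ) : Prop :=
  ∀ P ∈ K, ∀ Q ∈ K, ∀ l ∈ Icc (0:ℝ) 1,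
    l * P.2 + (1 - l) * Q.2 ≤ Φ (l * P.1 + (1 - l) * Q.1)

section Chords

variable {K : Set (ℝ × ℝ)} {Φ : ℝ → ℝ} {p s₀ : ℝ}

lemma ChordsBelow.le_tangent_of_between (hK : ChordsBelow K Φ) (hΦ : HasDerivAt Φ p s₀)
    {P Q : ℝ × ℝ} (hP : P ∈ K) (hQ : Q ∈ K) (hQe : Φ s₀ + p * (Q.1 - s₀) ≤ Q.2)
    {τ : ℝ} (hτ : τ ∈ Icc (0:ℝ) 1) (hs : τ * P.1 + (1 - τ) * Q.1 = s₀) :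
    P.2 ≤ Φ s₀ + p * (P.1 - s₀) := by
  rcases hτ.1.eq_or_lt with h0 | h0
  · subst h0
    have hQs : Q.1 = s₀ := by linarith
    rw [hQs] at hQe
    have hg : HasDerivAt (fun m : ℝ => Φ (m * P.1 + (1 - m) * s₀) - m * (P.2 - Φ s₀))
        (p * (P.1 - s₀) - (P.2 - Φ s₀)) 0 := by
      have h1 := hasDerivAt_convexComb P.1 s₀ 0
      have h2 : HasDerivAt Φ p ((0:ℝ) * P.1 + (1 - 0) * s₀) := by
        simpa using hΦ
      have h3 := (hasDerivAt_id (0:ℝ)).mul_const (P.2 - Φ s₀)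
      exact ((HasDerivAt.comp (0:ℝ) h2 h1).sub h3).congr_deriv (by ring)
    have := hg.nonneg_of_le_right zero_lt_one (fun m hm => by
      have := hK P hP Q hQ m ⟨hm.1.le, hm.2.le⟩
      rw [hQs] at this
      have h4 : (1 - m) * Φ s₀ ≤ (1 - m) * Q.2 :=
        mul_le_mul_of_nonneg_left (by linarith) (by linarith [hm.2])
      simp only [zero_mul, sub_zero, one_mul, zero_add]
      nlinarith)
    linarith
  · have h1 := hK P hP Q hQ τ hτ
    rw [hs] at h1
    have h2 := mul_le_mul_of_nonneg_left hQe (sub_nonneg.2 hτ.2)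
    have h3 : τ * (P.2 - (Φ s₀ + p * (P.1 - s₀))) ≤ 0 := by
      have : p * (τ * P.1 + (1 - τ) * Q.1 - s₀) = 0 := by rw [hs]; ring
      nlinarith
    by_contra! h4
    exact absurd h3 (not_le.2 (mul_pos h0 (by linarith)))

variable {P₁ P₂ : ℝ × ℝ} {l : ℝ}

lemma ChordsBelow.isLocalMax (hK : ChordsBelow K Φ) (h₁ : P₁ ∈ K) (h₂ : P₂ ∈ K)
    (hl : l ∈ Ioo (0:ℝ) 1) (hs : l * P₁.1 + (1 - l) * P₂.1 = s₀)
    (hw : l * P₁.2 + (1 - l) * P₂.2 = Φ s₀) :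
    IsLocalMax (fun m : ℝ => m * P₁.2 + (1 - m) * P₂.2 - Φ (m * P₁.1 + (1 - m) * P₂.1)) l := by
  filter_upwards [Ioo_mem_nhds hl.1 hl.2] with m hm
  have := hK P₁ h₁ P₂ h₂ m ⟨hm.1.le, hm.2.le⟩
  rw [hs, hw]
  linarith

/-- If a nondegenerate chord touches the graph of `Φ`, then its end points lie on the tangent. -/
lemma ChordsBelow.endpoints_on_tangent (hK : ChordsBelow K Φ) (hΦ : HasDerivAt Φ p s₀)
    (h₁ : P₁ ∈ K) (h₂ : P₂ ∈ K) (hl : l ∈ Ioo (0:ℝ) 1)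
    (hs : l * P₁.1 + (1 - l) * P₂.1 = s₀) (hw : l * P₁.2 + (1 - l) * P₂.2 = Φ s₀) :
    P₁.2 = Φ s₀ + p * (P₁.1 - s₀) ∧ P₂.2 = Φ s₀ + p * (P₂.1 - s₀) := by
  have hd := (hasDerivAt_convexComb P₁.2 P₂.2 l).sub
    (HasDerivAt.comp l (by rw [hs]; exact hΦ) (hasDerivAt_convexComb P₁.1 P₂.1 l))
  have h0 := (hK.isLocalMax h₁ h₂ hl hs hw).hasDerivAt_eq_zero hd
  subst hs
  exact ⟨by linear_combination hw + (1 - l) * h0, by linear_combination hw - l * h0⟩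

lemma ChordsBelow.le_tangent (hK : ChordsBelow K Φ) (hΦ : HasDerivAt Φ p s₀)
    (h₁ : P₁ ∈ K) (h₂ : P₂ ∈ K) (hl : l ∈ Icc (0:ℝ) 1)
    (hs : l * P₁.1 + (1 - l) * P₂.1 = s₀) (hw : l * P₁.2 + (1 - l) * P₂.2 = Φ s₀)
    {P : ℝ × ℝ} (hP : P ∈ K) : P.2 ≤ Φ s₀ + p * (P.1 - s₀) := by
  have hex : (∃ Q ∈ K, Q.1 ≤ s₀ ∧ Φ s₀ + p * (Q.1 - s₀) ≤ Q.2) ∧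
      ∃ Q ∈ K, s₀ ≤ Q.1 ∧ Φ s₀ + p * (Q.1 - s₀) ≤ Q.2 := by
    rcases hl.1.eq_or_lt with h0 | h0
    · subst h0
      have e1 : P₂.1 = s₀ := by linarith
      have e2 : P₂.2 = Φ s₀ := by linarith
      exact ⟨⟨P₂, h₂, by simp [e1, e2]⟩, ⟨P₂, h₂, by simp [e1, e2]⟩⟩
    rcases hl.2.eq_or_lt with h1 | h1
    · subst h1
      have e1 : P₁.1 = s₀ := by linarith
      have e2 : P₁.2 = Φ s₀ := by linarith
      exact ⟨⟨P₁, h₁, by simp [e1, e2]⟩, ⟨P₁, h₁, by simp [e1, e2]⟩⟩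
    obtain ⟨t1, t2⟩ := hK.endpoints_on_tangent hΦ h₁ h₂ ⟨h0, h1⟩ hs hw
    rcases le_total P₁.1 P₂.1 with h | h
    · exact ⟨⟨P₁, h₁, by nlinarith, t1.ge⟩, ⟨P₂, h₂, by nlinarith, t2.ge⟩⟩
    · exact ⟨⟨P₂, h₂, by nlinarith, t2.ge⟩, ⟨P₁, h₁, by nlinarith, t1.ge⟩⟩
  have key : ∀ Q ∈ K, Φ s₀ + p * (Q.1 - s₀) ≤ Q.2 → s₀ ∈ segment ℝ P.1 Q.1 →
      P.2 ≤ Φ s₀ + p * (P.1 - s₀) := by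
    rintro Q hQ hQe ⟨a, b, ha, hb, hab, h⟩
    obtain rfl : b = 1 - a := by linarith
    exact hK.le_tangent_of_between hΦ hP hQ hQe ⟨ha, by linarith⟩ h
  obtain ⟨⟨Q, hQ, hQs, hQe⟩, R, hR, hRs, hRe⟩ := hex
  rcases le_total P.1 s₀ with h | h
  · exact key R hR hRe (by rw [segment_eq_Icc (h.trans hRs)]; exact ⟨h, hRs⟩)
  · exact key Q hQ hQe (by rw [segment_symm, segment_eq_Icc (hQs.trans h)]; exact ⟨hQs, h⟩)

/-- Where a strictly concave graph is touched by a chord, it is touched by a point of `K`. -/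
lemma ChordsBelow.exists_mem_of_second_deriv_neg (hK : ChordsBelow K Φ) {Φ' : ℝ → ℝ} {Φ'' : ℝ}
    (hΦ : ∀ᶠ s in 𝓝 s₀, HasDerivAt Φ (Φ' s) s) (hΦ' : HasDerivAt Φ' Φ'' s₀) (hneg : Φ'' < 0)
    (h₁ : P₁ ∈ K) (h₂ : P₂ ∈ K) (hl : l ∈ Icc (0:ℝ) 1)
    (hs : l * P₁.1 + (1 - l) * P₂.1 = s₀) (hw : l * P₁.2 + (1 - l) * P₂.2 = Φ s₀) :
    ∃ P ∈ K, P.1 = s₀ ∧ P.2 = Φ s₀ := by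
  rcases hl.1.eq_or_lt with h0 | h0
  · subst h0
    exact ⟨P₂, h₂, by linarith, by linarith⟩
  rcases hl.2.eq_or_lt with h1 | h1
  · subst h1
    exact ⟨P₁, h₁, by linarith, by linarith⟩
  have t1 := (hK.endpoints_on_tangent hΦ.self_of_nhds h₁ h₂ ⟨h0, h1⟩ hs hw).1
  by_cases heq : P₁.1 = P₂.1
  · have e1 : P₁.1 = s₀ := by rw [← hs, ← heq]; ring
    exact ⟨P₁, h₁, e1, by rw [t1, e1]; ring⟩
  have hmax := hK.isLocalMax h₁ h₂ ⟨h0, h1⟩ hs hw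
  have hcont : Tendsto (fun m : ℝ => m * P₁.1 + (1 - m) * P₂.1) (𝓝 l) (𝓝 s₀) := by
    have := (hasDerivAt_convexComb P₁.1 P₂.1 l).continuousAt.tendsto
    rwa [hs] at this
  have hd : ∀ᶠ m in 𝓝 l, HasDerivAt
      (fun m : ℝ => m * P₁.2 + (1 - m) * P₂.2 - Φ (m * P₁.1 + (1 - m) * P₂.1))
      (P₁.2 - P₂.2 - Φ' (m * P₁.1 + (1 - m) * P₂.1) * (P₁.1 - P₂.1)) m := by
    filter_upwards [hcont.eventually hΦ] with m hm
    exact (hasDerivAt_convexComb P₁.2 P₂.2 m).sub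
      (HasDerivAt.comp m hm (hasDerivAt_convexComb P₁.1 P₂.1 m))
  have hd2 : HasDerivAt
      (fun m : ℝ => P₁.2 - P₂.2 - Φ' (m * P₁.1 + (1 - m) * P₂.1) * (P₁.1 - P₂.1))
      (-(Φ'' * (P₁.1 - P₂.1) * (P₁.1 - P₂.1))) l :=
    ((HasDerivAt.comp l (by rw [hs]; exact hΦ')
      (hasDerivAt_convexComb P₁.1 P₂.1 l)).mul_const (P₁.1 - P₂.1)).const_sub _
  have h2 := hmax.second_deriv_nonpos hd hd2
  have h3 : 0 < (P₁.1 - P₂.1) ^ 2 := by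
    have := sub_ne_zero.2 heq
    positivity
  nlinarith

end Chords

/-- The increments of `v` over intervals of length at most `L`. -/
def increments (L : ℝ) (v : ℝ → ℝ) : Set (ℝ × ℝ) :=
  {P | ∃ x, ∃ s ∈ Icc 0 L, P = (s, v (x + s) - v x)}

section Increments

variable {L : ℝ} {v v' v'' : ℝ → ℝ} {x s : ℝ}

lemma second_deriv_of_increments_le_linear (hv : ∀ x, HasDerivAt v (v' x) x)
    (hv' : ∀ x, HasDerivAt v' (v'' x) x) {c p : ℝ}
    (h : ∀ P ∈ increments L v, P.2 ≤ c + p * P.1) (hs : s ∈ Ioo 0 L)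
    (heq : v (x + s) - v x = c + p * s) : v'' (x + s) ≤ 0 ∧ 0 ≤ v'' x := by
  have hlin (y : ℝ) : HasDerivAt (fun y : ℝ => p * y) p y := by
    simpa using (hasDerivAt_id y).const_mul p
  constructor
  · have hmax : IsLocalMax (fun y => v y - p * y) (x + s) := by
      filter_upwards [Ioo_mem_nhds (lt_add_of_pos_right x hs.1)
        (show x + s < x + L by linarith [hs.2])] with y hy
      have := h _ ⟨x, y - x, ⟨by linarith [hy.1], by linarith [hy.2]⟩, rfl⟩
      simp only [add_sub_cancel] at this
      linarith
    exact hmax.second_deriv_nonpos (f' := fun y => v' y - p)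
      (Eventually.of_forall fun y => (hv y).sub (hlin y)) ((hv' (x + s)).sub_const p)
  · have hmax : IsLocalMax (fun y => p * y - v y) x := by
      filter_upwards [Ioo_mem_nhds (show x + s - L < x by linarith [hs.2])
        (lt_add_of_pos_right x hs.1)] with y hy
      have := h _ ⟨y, x + s - y, ⟨by linarith [hy.2], by linarith [hy.1]⟩, rfl⟩
      simp only [add_sub_cancel] at this
      linarith
    have := hmax.second_deriv_nonpos (f' := fun y => p - v' y)
      (Eventually.of_forall fun y => (hlin y).sub (hv y)) ((hv' x).const_sub p)
    linarith

lemma second_deriv_of_increments_le (hv : ∀ x, HasDerivAt v (v' x) x)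
    (hv' : ∀ x, HasDerivAt v' (v'' x) x) {Φ Φ' : ℝ → ℝ} {Φ'' : ℝ}
    (hΦ : ∀ᶠ r in 𝓝 s, HasDerivAt Φ (Φ' r) r) (hΦ' : HasDerivAt Φ' Φ'' s)
    (h : ∀ P ∈ increments L v, P.2 ≤ Φ P.1) (hs : s ∈ Ioo 0 L)
    (heq : v (x + s) - v x = Φ s) :
    v' (x + s) = Φ' s ∧ v' x = Φ' s ∧
      ∀ ξ η : ℝ, ξ ^ 2 * v'' (x + s) - η ^ 2 * v'' x ≤ (ξ - η) ^ 2 * Φ'' := by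
  have haff (c ξ m : ℝ) : HasDerivAt (fun m : ℝ => c + ξ * m) ξ m := by
    simpa using ((hasDerivAt_id m).const_mul ξ).const_add c
  have htend (c ξ : ℝ) : Tendsto (fun m : ℝ => c + ξ * m) (𝓝 0) (𝓝 c) := by
    simpa using (haff c ξ 0).continuousAt.tendsto
  have hmax (ξ η : ℝ) :
      IsLocalMax (fun m => v (x + s + ξ * m) - v (x + η * m) - Φ (s + (ξ - η) * m)) 0 := by
    filter_upwards [(htend s (ξ - η)).eventually (Ioo_mem_nhds hs.1 hs.2)] with m hm
    have := h _ ⟨x + η * m, s + (ξ - η) * m, ⟨hm.1.le, hm.2.le⟩, rfl⟩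
    rw [show x + η * m + (s + (ξ - η) * m) = x + s + ξ * m by ring] at this
    simp only [mul_zero, add_zero]
    simp only at this
    linarith
  have hd (ξ η : ℝ) : ∀ᶠ m in 𝓝 (0:ℝ), HasDerivAt
      (fun m => v (x + s + ξ * m) - v (x + η * m) - Φ (s + (ξ - η) * m))
      (v' (x + s + ξ * m) * ξ - v' (x + η * m) * η - Φ' (s + (ξ - η) * m) * (ξ - η)) m := by
    filter_upwards [(htend s (ξ - η)).eventually hΦ] with m hm
    exact (((hv _).comp m (haff _ ξ m)).sub ((hv _).comp m (haff _ η m))).sub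
      (HasDerivAt.comp m hm (haff _ _ m))
  have hfirst (ξ η : ℝ) : v' (x + s) * ξ - v' x * η - Φ' s * (ξ - η) = 0 := by
    simpa using (hmax ξ η).hasDerivAt_eq_zero (hd ξ η).self_of_nhds
  refine ⟨by linarith [hfirst 1 0], by linarith [hfirst 0 1], fun ξ η => ?_⟩
  have hΦ0 : HasDerivAt Φ' Φ'' (s + (ξ - η) * 0) := by simpa using hΦ'
  have h2 := (hmax ξ η).second_deriv_nonpos (hd ξ η)
    (((((hv' _).comp 0 (haff _ ξ 0)).mul_const ξ).sub
      (((hv' _).comp 0 (haff _ η 0)).mul_const η)).sub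
      ((HasDerivAt.comp (0:ℝ) hΦ0 (haff _ _ 0)).mul_const (ξ - η)))
  simp only [mul_zero, add_zero] at h2
  linarith

end Increments

section Comparison

variable {L T : ℝ} {u : ℝ → ℝ → ℝ}

lemma mem_increments_iff_of_periodic (hL : 0 < L) {v : ℝ → ℝ} (hv : ∀ x, v (x + L) = v x)
    {P : ℝ × ℝ} :
    P ∈ increments L v ↔ ∃ x ∈ Icc 0 L, ∃ s ∈ Icc 0 L, P = (s, v (x + s) - v x) := by
  constructor
  · rintro ⟨x, s, hs, rfl⟩
    have hper : Function.Periodic (fun x => v (x + s) - v x) L := fun x => by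
      simp only [hv x, show x + L + s = x + s + L by ring, hv (x + s)]
    obtain ⟨y, hy, hxy⟩ := hper.exists_mem_Ico₀ hL x
    exact ⟨y, Ico_subset_Icc_self hy, s, hs, by simpa using hxy⟩
  · rintro ⟨x, -, s, hs, rfl⟩
    exact ⟨x, s, hs, rfl⟩

lemma exists_increments_bound (hL : 0 < L) (hu_reg : RegularOn u (univ ×ˢ Icc 0 T))
    (hu_per : ∀ x t : ℝ, u (x + L) t = u x t) :
    ∃ M, 0 ≤ M ∧ ∀ t ∈ Icc 0 T, ∀ P ∈ increments L (fun x => u x t),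
      P.2 ≤ M * P.1 ∧ P.2 ≤ M * (L - P.1) := by
  obtain ⟨-, hdx, -, -, hcx, -, -⟩ := hu_reg
  obtain ⟨M, hM⟩ := ((isCompact_Icc (a := 0) (b := L)).prod
    (isCompact_Icc (a := 0) (b := T))).exists_bound_of_continuousOn
    (hcx.mono (prod_mono (subset_univ _) le_rfl))
  have hbound : ∀ t ∈ Icc 0 T, ∀ x, ‖deriv (fun y => u y t) x‖ ≤ max M 0 := by
    intro t ht x
    have hper : Function.Periodic (deriv fun y => u y t) L := fun x => by
      rw [← deriv_comp_add_const]
      simp only [hu_per]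
    obtain ⟨y, hy, hxy⟩ := hper.exists_mem_Ico₀ hL x
    rw [hxy]
    exact (hM (y, t) ⟨Ico_subset_Icc_self hy, ht⟩).trans (le_max_left _ _)
  have hlip : ∀ t ∈ Icc 0 T, ∀ x y, x ≤ y → |u y t - u x t| ≤ max M 0 * (y - x) := by
    intro t ht x y hxy
    have := Convex.norm_image_sub_le_of_norm_deriv_le (f := fun y => u y t) (C := max M 0)
      (s := univ) (x := x) (y := y) (fun z _ => hdx (z, t) ⟨trivial, ht⟩)
      (fun z _ => hbound t ht z) convex_univ trivial trivial
    rwa [Real.norm_eq_abs, Real.norm_eq_abs, abs_of_nonneg (sub_nonneg.2 hxy)] at this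
  refine ⟨max M 0, le_max_right _ _, ?_⟩
  rintro t ht _ ⟨x, s, hs, rfl⟩
  have h1 := (abs_le.1 (hlip t ht x (x + s) (by linarith [hs.1]))).2
  have h2 := (abs_le.1 (hlip t ht (x + s) (x + L) (by linarith [hs.2]))).1
  rw [hu_per] at h2
  constructor
  · simpa using h1
  · have : x + L - (x + s) = L - s := by ring
    rw [this] at h2
    linarith

/-- The concave hull of the increments of the initial datum lies below the initial supersolution. -/
lemma chord_le_initial {v ψ φ : ℝ → ℝ} (hv : Continuous v)
    (hψconc : ConcaveOn ℝ (Ioo 0 (L/2)) ψ) (hψmod : IsModulus L ψ v)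
    (hφ : ContinuousOn φ (Ioo 0 (L/2))) (hψφ : ∀ z ∈ Ioo 0 (L/2), ψ z ≤ φ z)
    {P Q : ℝ × ℝ} (hP : P ∈ increments L v) (hQ : Q ∈ increments L v) {l : ℝ}
    (hl : l ∈ Icc (0:ℝ) 1) (hs : l * P.1 + (1 - l) * Q.1 ∈ Ioo 0 L) :
    l * P.2 + (1 - l) * Q.2 ≤ 2 * φ ((l * P.1 + (1 - l) * Q.1) / 2) := by
  obtain ⟨x₁, s₁, hs₁, rfl⟩ := hP
  obtain ⟨x₂, s₂, hs₂, rfl⟩ := hQ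
  simp only at hs ⊢
  have hL : 0 < L := hs.1.trans hs.2
  let r (s τ : ℝ) : ℝ := s + τ * (L / 2 - s)
  have hr (s : ℝ) : Continuous (r s) := by fun_prop
  have hr0 (s : ℝ) : r s 0 = s := by simp [r]
  have hrmem (s : ℝ) (hs : s ∈ Icc 0 L) (τ : ℝ) (hτ : τ ∈ Ioo (0:ℝ) 1) : r s τ ∈ Ioo 0 L := by
    have h1 := mul_pos hτ.1 hL
    have h2 := mul_nonneg (sub_nonneg.2 hτ.2.le) hs.1
    have h3 := mul_nonneg (sub_nonneg.2 hτ.2.le) (sub_nonneg.2 hs.2)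
    constructor <;> simp only [r] <;> nlinarith
  have hle : ∀ᶠ τ in 𝓝[>] (0:ℝ),
      l * (v (x₁ + r s₁ τ) - v x₁) + (1 - l) * (v (x₂ + r s₂ τ) - v x₂) ≤
        2 * φ ((l * r s₁ τ + (1 - l) * r s₂ τ) / 2) := by
    filter_upwards [Ioo_mem_nhdsGT zero_lt_one] with τ hτ
    obtain ⟨a1, b1⟩ := hrmem s₁ hs₁ τ hτ
    obtain ⟨a2, b2⟩ := hrmem s₂ hs₂ τ hτ
    have m1 := (hψmod x₁ (x₁ + r s₁ τ) (by simpa using a1) (by simpa using b1)).2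
    have m2 := (hψmod x₂ (x₂ + r s₂ τ) (by simpa using a2) (by simpa using b2)).2
    rw [add_sub_cancel_left] at m1 m2
    have z1 : r s₁ τ / 2 ∈ Ioo 0 (L/2) := ⟨by linarith, by linarith⟩
    have z2 : r s₂ τ / 2 ∈ Ioo 0 (L/2) := ⟨by linarith, by linarith⟩
    have hl' : 0 ≤ 1 - l := sub_nonneg.2 hl.2
    have hc := hψconc.2 z1 z2 hl.1 hl' (by ring)
    have hmem := hψconc.1 z1 z2 hl.1 hl' (by ring)
    simp only [smul_eq_mul] at hc hmem
    have := hψφ _ hmem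
    rw [show (l * r s₁ τ + (1 - l) * r s₂ τ) / 2 = l * (r s₁ τ / 2) + (1 - l) * (r s₂ τ / 2) by
      ring]
    have := mul_le_mul_of_nonneg_left m1 hl.1
    have := mul_le_mul_of_nonneg_left m2 hl'
    linarith
  have hleft : Tendsto
      (fun τ => l * (v (x₁ + r s₁ τ) - v x₁) + (1 - l) * (v (x₂ + r s₂ τ) - v x₂)) (𝓝[>] (0:ℝ))
      (𝓝 (l * (v (x₁ + s₁) - v x₁) + (1 - l) * (v (x₂ + s₂) - v x₂))) := by
    have hc : Continuous
        (fun τ => l * (v (x₁ + r s₁ τ) - v x₁) + (1 - l) * (v (x₂ + r s₂ τ) - v x₂)) := by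
      fun_prop
    simpa only [hr0] using (hc.tendsto 0).mono_left nhdsWithin_le_nhds
  have hright : Tendsto (fun τ => 2 * φ ((l * r s₁ τ + (1 - l) * r s₂ τ) / 2)) (𝓝[>] (0:ℝ))
      (𝓝 (2 * φ ((l * s₁ + (1 - l) * s₂) / 2))) := by
    have hφc : ContinuousAt φ ((l * s₁ + (1 - l) * s₂) / 2) :=
      hφ.continuousAt (Ioo_mem_nhds (by linarith [hs.1]) (by linarith [hs.2]))
    have hc : Continuous fun τ => (l * r s₁ τ + (1 - l) * r s₂ τ) / 2 := by fun_prop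
    have ht : Tendsto (fun τ => (l * r s₁ τ + (1 - l) * r s₂ τ) / 2) (𝓝[>] (0:ℝ))
        (𝓝 ((l * s₁ + (1 - l) * s₂) / 2)) := by
      simpa only [hr0] using (hc.tendsto 0).mono_left nhdsWithin_le_nhds
    exact (hφc.tendsto.comp ht).const_mul 2
  exact le_of_tendsto_of_tendsto hleft hright hle

variable {α ψ : ℝ → ℝ} {a : ℝ → ℝ → ℝ → ℝ → ℝ} {φ : ℝ → ℝ → ℝ}

/-- A supersolution shifted by `ε * (1 + t) + m` cannot touch the concave hull of the increments of
a solution at a positive time. -/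
lemma not_touching (hαpos : ∀ p, 0 < α p) (ha_lower : ∀ x t w p : ℝ, α p ≤ a x t w p)
    (hu_reg : RegularOn u (univ ×ˢ Icc 0 T)) (hu_per : ∀ x t : ℝ, u (x + L) t = u x t)
    (hu_eq : ∀ x : ℝ, ∀ t ∈ Icc (0:ℝ) T,
      pderivT u x t = a x t (u x t) (pderivX u x t) * pderivXX u x t)
    (hφ : MemS α L ψ φ) {ε m : ℝ} (hε : 0 < ε)
    (hall : ∀ t ∈ Icc 0 T, ChordsBelow (increments L fun x => u x t)
      fun s => 2 * φ (s / 2) t + (ε * (1 + t) + m))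
    {t₀ l x₁ s₁ x₂ s₂ : ℝ} (ht₀ : t₀ ∈ Ioc 0 T) (hl : l ∈ Icc (0:ℝ) 1)
    (hs₁ : s₁ ∈ Icc 0 L) (hs₂ : s₂ ∈ Icc 0 L) (hs : l * s₁ + (1 - l) * s₂ ∈ Ioo 0 L) :
    l * (u (x₁ + s₁) t₀ - u x₁ t₀) + (1 - l) * (u (x₂ + s₂) t₀ - u x₂ t₀) ≠
      2 * φ ((l * s₁ + (1 - l) * s₂) / 2) t₀ + (ε * (1 + t₀) + m) := by
  intro heq
  obtain ⟨-, hux, huxx, hut, -, -, -⟩ := hu_reg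
  obtain ⟨-, -, ⟨-, hφx, hφxx, hφt, -, -, -⟩, hsuper, -⟩ := hφ
  have ht₀' : t₀ ∈ Icc 0 T := Ioc_subset_Icc_self ht₀
  have hK := hall t₀ ht₀'
  have hz : ∀ s ∈ Ioo 0 L, (s / 2, t₀) ∈ Ioo 0 (L/2) ×ˢ Ioi (0:ℝ) := fun s hs =>
    ⟨⟨by linarith [hs.1], by linarith [hs.2]⟩, ht₀.1⟩
  set s₀ := l * s₁ + (1 - l) * s₂ with hs₀
  have hv (x : ℝ) : HasDerivAt (fun x => u x t₀) (pderivX u x t₀) x :=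
    (hux (x, t₀) ⟨trivial, ht₀'⟩).hasDerivAt
  have hv' (x : ℝ) : HasDerivAt (fun x => pderivX u x t₀) (pderivXX u x t₀) x :=
    (huxx (x, t₀) ⟨trivial, ht₀'⟩).hasDerivAt
  have hvt (x : ℝ) : HasDerivAt (fun t => u x t) (pderivT u x t₀) t₀ :=
    (hut (x, t₀) ⟨trivial, ht₀'⟩).hasDerivAt
  have hhalf (s : ℝ) : HasDerivAt (fun s : ℝ => s / 2) (1 / 2) s :=
    (hasDerivAt_id s).div_const 2
  have hΦ : ∀ᶠ s in 𝓝 s₀, HasDerivAt (fun s => 2 * φ (s / 2) t₀ + (ε * (1 + t₀) + m))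
      (pderivX φ (s / 2) t₀) s := by
    filter_upwards [Ioo_mem_nhds hs.1 hs.2] with s hs
    have h1 : HasDerivAt (fun y => φ y t₀) (pderivX φ (s / 2) t₀) (s / 2) :=
      (hφx _ (hz s hs)).hasDerivAt
    exact (((HasDerivAt.comp s h1 (hhalf s)).const_mul 2).add_const _).congr_deriv (by ring)
  have hΦ' : HasDerivAt (fun s => pderivX φ (s / 2) t₀) (pderivXX φ (s₀ / 2) t₀ * (1 / 2)) s₀ := by
    have h1 : HasDerivAt (fun y => pderivX φ y t₀) (pderivXX φ (s₀ / 2) t₀) (s₀ / 2) :=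
      (hφxx _ (hz s₀ hs)).hasDerivAt
    exact HasDerivAt.comp s₀ h1 (hhalf s₀)
  have hφt₀ : HasDerivAt (fun t => φ (s₀ / 2) t) (pderivT φ (s₀ / 2) t₀) t₀ :=
    (hφt _ (hz s₀ hs)).hasDerivAt
  have htime : ∀ l ∈ Icc (0:ℝ) 1, ∀ x₁ x₂, ∀ s₁ ∈ Icc 0 L, ∀ s₂ ∈ Icc 0 L,
      l * s₁ + (1 - l) * s₂ = s₀ →
      l * (u (x₁ + s₁) t₀ - u x₁ t₀) + (1 - l) * (u (x₂ + s₂) t₀ - u x₂ t₀) =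
        2 * φ (s₀ / 2) t₀ + (ε * (1 + t₀) + m) →
      2 * pderivT φ (s₀ / 2) t₀ + ε ≤ l * (pderivT u (x₁ + s₁) t₀ - pderivT u x₁ t₀) +
        (1 - l) * (pderivT u (x₂ + s₂) t₀ - pderivT u x₂ t₀) := by
    intro l hl x₁ x₂ s₁ hs₁ s₂ hs₂ hs heq
    have hd := ((((hvt (x₁ + s₁)).sub (hvt x₁)).const_mul l).add
      (((hvt (x₂ + s₂)).sub (hvt x₂)).const_mul (1 - l))).sub ((hφt₀.const_mul 2).add
      ((((hasDerivAt_id t₀).const_add 1).const_mul ε).add_const m))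
    have := hd.nonneg_of_le_left ht₀.1 fun t ht => by
      have := hall t ⟨ht.1.le, ht.2.le.trans ht₀.2⟩ _ ⟨x₁, s₁, hs₁, rfl⟩ _ ⟨x₂, s₂, hs₂, rfl⟩ l hl
      simp only [hs] at this
      simp only [Pi.add_apply, Pi.sub_apply, id]
      linarith
    linarith
  have hP₁ : (s₁, u (x₁ + s₁) t₀ - u x₁ t₀) ∈ increments L fun x => u x t₀ := ⟨x₁, s₁, hs₁, rfl⟩
  have hP₂ : (s₂, u (x₂ + s₂) t₀ - u x₂ t₀) ∈ increments L fun x => u x t₀ := ⟨x₂, s₂, hs₂, rfl⟩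
  have hpos (x : ℝ) : 0 < a x t₀ (u x t₀) (pderivX u x t₀) := (hαpos _).trans_le (ha_lower _ _ _ _)
  set p := pderivX φ (s₀ / 2) t₀
  set w₀ := 2 * φ (s₀ / 2) t₀ + (ε * (1 + t₀) + m)
  have htangent : ∀ P ∈ increments L (fun x => u x t₀), P.2 ≤ (w₀ - p * s₀) + p * P.1 := by
    intro P hP
    have := hK.le_tangent hΦ.self_of_nhds hP₁ hP₂ hl rfl heq hP
    linarith
  have hsign : ∀ x, ∀ s ∈ Icc 0 L, u (x + s) t₀ - u x t₀ = (w₀ - p * s₀) + p * s →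
      pderivT u (x + s) t₀ - pderivT u x t₀ ≤ 0 := by
    intro x s hs hxs
    rcases hs.1.eq_or_lt with h0 | h0
    · simp [← h0]
    rcases hs.2.eq_or_lt with h1 | h1
    · have : pderivT u (x + s) t₀ = pderivT u x t₀ := by
        simp only [pderivT, h1, hu_per]
      linarith
    obtain ⟨d1, d2⟩ := second_deriv_of_increments_le_linear hv hv' htangent ⟨h0, h1⟩ hxs
    rw [hu_eq _ _ ht₀', hu_eq _ _ ht₀']
    have := mul_nonpos_of_nonneg_of_nonpos (hpos (x + s)).le d1
    have := mul_nonneg (hpos x).le d2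
    linarith
  have e₁ := htangent _ hP₁
  have e₂ := htangent _ hP₂
  have hl' : 0 ≤ 1 - l := sub_nonneg.2 hl.2
  simp only at e₁ e₂
  have hsum : l * (w₀ - p * s₀ + p * s₁ - (u (x₁ + s₁) t₀ - u x₁ t₀)) +
      (1 - l) * (w₀ - p * s₀ + p * s₂ - (u (x₂ + s₂) t₀ - u x₂ t₀)) = 0 := by
    linear_combination p * hs₀.symm - heq
  have n₁ := mul_nonneg hl.1 (sub_nonneg.2 e₁)
  have n₂ := mul_nonneg hl' (sub_nonneg.2 e₂)
  have r₁ : l * (pderivT u (x₁ + s₁) t₀ - pderivT u x₁ t₀) ≤ 0 := by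
    rcases mul_eq_zero.1 (show _ = (0:ℝ) by linarith only [n₁, n₂, hsum] :
        l * (w₀ - p * s₀ + p * s₁ - (u (x₁ + s₁) t₀ - u x₁ t₀)) = 0) with h | h
    · simp [h]
    · exact mul_nonpos_of_nonneg_of_nonpos hl.1 (hsign x₁ s₁ hs₁ (by linarith))
  have r₂ : (1 - l) * (pderivT u (x₂ + s₂) t₀ - pderivT u x₂ t₀) ≤ 0 := by
    rcases mul_eq_zero.1 (show _ = (0:ℝ) by linarith only [n₁, n₂, hsum] :
        (1 - l) * (w₀ - p * s₀ + p * s₂ - (u (x₂ + s₂) t₀ - u x₂ t₀)) = 0) with h | h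
    · simp [h]
    · exact mul_nonpos_of_nonneg_of_nonpos hl' (hsign x₂ s₂ hs₂ (by linarith))
  have hφs := hsuper (s₀ / 2) t₀ (hz s₀ hs).1 ht₀.1
  have hneg : pderivXX φ (s₀ / 2) t₀ < 0 := by
    by_contra! h
    have := mul_nonneg (hαpos (pderivX φ (s₀ / 2) t₀)).le h
    linarith [htime l hl x₁ x₂ s₁ hs₁ s₂ hs₂ rfl heq]
  obtain ⟨_, ⟨x, s, hsI, rfl⟩, hss, hxs⟩ :=
    hK.exists_mem_of_second_deriv_neg hΦ hΦ' (by linarith) hP₁ hP₂ hl rfl heq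
  simp only at hss hxs
  rw [hss] at hsI hxs
  obtain ⟨f1, f2, f3⟩ := second_deriv_of_increments_le hv hv' hΦ hΦ'
    (fun P hP => by simpa using hK P hP P hP 1 (by simp)) hs hxs
  have hfinal := htime 1 (by simp) x x s₀ hsI s₀ hsI (by ring) (by simpa using hxs)
  have g := f3 (√(a (x + s₀) t₀ (u (x + s₀) t₀) (pderivX u (x + s₀) t₀)))
    (-√(a x t₀ (u x t₀) (pderivX u x t₀)))
  have hA := Real.sqrt_le_sqrt (ha_lower (x + s₀) t₀ (u (x + s₀) t₀) (pderivX u (x + s₀) t₀))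
  have hB := Real.sqrt_le_sqrt (ha_lower x t₀ (u x t₀) (pderivX u x t₀))
  rw [neg_sq, Real.sq_sqrt (hpos _).le, Real.sq_sqrt (hpos _).le, ← hu_eq _ _ ht₀',
    ← hu_eq _ _ ht₀', sub_neg_eq_add] at g
  rw [f1] at hA g
  rw [f2] at hB g
  have hsq : 4 * α p ≤ (√(a (x + s₀) t₀ (u (x + s₀) t₀) p) + √(a x t₀ (u x t₀) p)) ^ 2 := by
    have h4 : 4 * α p = (√(α p) + √(α p)) ^ 2 := by
      rw [← two_mul, mul_pow, Real.sq_sqrt (hαpos p).le]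
      norm_num
    rw [h4]
    gcongr
  have := mul_le_mul_of_nonpos_right hsq (show pderivXX φ (s₀ / 2) t₀ * (1 / 2) ≤ 0 by linarith)
  linarith

/-- Comparison of the concave hull of the increments of a solution with a supersolution. -/
lemma chordsBelow_of_memS (hαpos : ∀ p, 0 < α p) (hL : 0 < L)
    (ha_lower : ∀ x t w p : ℝ, α p ≤ a x t w p)
    (hu_reg : RegularOn u (univ ×ˢ Icc 0 T)) (hu_per : ∀ x t : ℝ, u (x + L) t = u x t)
    (hu_eq : ∀ x : ℝ, ∀ t ∈ Icc (0:ℝ) T,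
      pderivT u x t = a x t (u x t) (pderivX u x t) * pderivXX u x t)
    (hψconc : ConcaveOn ℝ (Ioo 0 (L/2)) ψ) (hψmod : IsModulus L ψ (fun x => u x 0))
    (hφ : MemS α L ψ φ) {ε : ℝ} (hε : 0 < ε) {t : ℝ} (ht : t ∈ Icc 0 T) :
    ChordsBelow (increments L fun x => u x t) fun s => 2 * φ (s / 2) t + ε * (1 + t) := by
  obtain ⟨M, hM0, hM⟩ := exists_increments_bound hL hu_reg hu_per
  set δ := ε / (M + 1) with hδ
  have hδpos : 0 < δ := by positivity
  have hMδ : M * δ < ε := by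
    rw [hδ, ← mul_div_assoc, div_lt_iff₀ (by positivity)]
    nlinarith
  obtain ⟨hφnn, hφcont, -, -, hφψ⟩ := id hφ
  have hedge : ∀ t ∈ Icc 0 T, ∀ P ∈ increments L (fun x => u x t),
      ∀ Q ∈ increments L (fun x => u x t), ∀ l ∈ Icc (0:ℝ) 1,
      2 * φ ((l * P.1 + (1 - l) * Q.1) / 2) t + ε * (1 + t) < l * P.2 + (1 - l) * Q.2 →
      l * P.1 + (1 - l) * Q.1 ∈ Icc δ (L - δ) := by
    intro t ht P hP Q hQ l hl h
    obtain ⟨p1, p2⟩ := hM t ht P hP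
    obtain ⟨q1, q2⟩ := hM t ht Q hQ
    have hl' : 0 ≤ 1 - l := sub_nonneg.2 hl.2
    have hmem : l * P.1 + (1 - l) * Q.1 ∈ Icc 0 L := by
      obtain ⟨_, s₁, hs₁, rfl⟩ := hP
      obtain ⟨_, s₂, hs₂, rfl⟩ := hQ
      exact (convex_Icc 0 L) hs₁ hs₂ hl.1 hl' (by ring)
    have := hφnn ((l * P.1 + (1 - l) * Q.1) / 2) t ⟨by linarith [hmem.1], by linarith [hmem.2]⟩ ht.1
    have := mul_nonneg hε.le ht.1
    have := mul_le_mul_of_nonneg_left p1 hl.1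
    have := mul_le_mul_of_nonneg_left p2 hl.1
    have := mul_le_mul_of_nonneg_left q1 hl'
    have := mul_le_mul_of_nonneg_left q2 hl'
    constructor
    · by_contra! hlt
      have := mul_le_mul_of_nonneg_left hlt.le hM0
      linarith
    · by_contra! hlt
      have := mul_le_mul_of_nonneg_left hlt.le hM0
      linarith
  by_contra hcon
  simp only [ChordsBelow, not_forall, not_le] at hcon
  obtain ⟨P, hP, Q, hQ, l, hl, hlt⟩ := hcon
  let S (p : ℝ × ℝ × ℝ × ℝ × ℝ × ℝ) : ℝ := p.1 * p.2.2.1 + (1 - p.1) * p.2.2.2.2.1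
  let Z (p : ℝ × ℝ × ℝ × ℝ × ℝ × ℝ) : ℝ :=
    p.1 * (u (p.2.1 + p.2.2.1) p.2.2.2.2.2 - u p.2.1 p.2.2.2.2.2) +
      (1 - p.1) * (u (p.2.2.2.1 + p.2.2.2.2.1) p.2.2.2.2.2 - u p.2.2.2.1 p.2.2.2.2.2) -
      (2 * φ (S p / 2) p.2.2.2.2.2 + ε * (1 + p.2.2.2.2.2))
  let B : Set (ℝ × ℝ × ℝ × ℝ × ℝ × ℝ) :=
    Icc 0 1 ×ˢ Icc 0 L ×ˢ Icc 0 L ×ˢ Icc 0 L ×ˢ Icc 0 L ×ˢ Icc 0 T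
  let D : Set (ℝ × ℝ × ℝ × ℝ × ℝ × ℝ) := B ∩ S ⁻¹' Icc δ (L - δ)
  have hS : Continuous S := by fun_prop
  have hDcompact : IsCompact D := by
    refine IsCompact.inter_right ?_ (isClosed_Icc.preimage hS)
    exact isCompact_Icc.prod (isCompact_Icc.prod (isCompact_Icc.prod (isCompact_Icc.prod
      (isCompact_Icc.prod isCompact_Icc))))
  have hDt : ∀ p ∈ D, p.2.2.2.2.2 ∈ Icc 0 T := fun p hp => hp.1.2.2.2.2.2
  have hucomp (f : ℝ × ℝ × ℝ × ℝ × ℝ × ℝ → ℝ) (hf : Continuous f) :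
      ContinuousOn (fun p => u (f p) p.2.2.2.2.2) D :=
    hu_reg.1.comp (f := fun p => (f p, p.2.2.2.2.2)) (by fun_prop)
      fun p hp => ⟨trivial, hDt p hp⟩
  have hφcomp : ContinuousOn (fun p => φ (S p / 2) p.2.2.2.2.2) D := by
    refine hφcont.comp (f := fun p => (S p / 2, p.2.2.2.2.2)) (by fun_prop) fun p hp => ?_
    obtain ⟨h1, h2⟩ := hp.2
    refine ⟨⟨⟨by simp only; linarith, by simp only; linarith⟩, (hDt p hp).1⟩, ?_⟩
    rintro (h | h)
    · have := congrArg Prod.fst h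
      simp only at this
      linarith
    · have := congrArg Prod.fst (mem_singleton_iff.1 h)
      simp only at this
      linarith
  have hZ : ContinuousOn Z D := by
    have c1 := hucomp (fun p => p.2.1 + p.2.2.1) (by fun_prop)
    have c2 := hucomp (fun p => p.2.1) (by fun_prop)
    have c3 := hucomp (fun p => p.2.2.2.1 + p.2.2.2.2.1) (by fun_prop)
    have c4 := hucomp (fun p => p.2.2.2.1) (by fun_prop)
    have cl : ContinuousOn (fun p : ℝ × ℝ × ℝ × ℝ × ℝ × ℝ => p.1) D := by fun_prop
    have ct : ContinuousOn (fun p : ℝ × ℝ × ℝ × ℝ × ℝ × ℝ => ε * (1 + p.2.2.2.2.2)) D := by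
      fun_prop
    exact ((cl.mul (c1.sub c2)).add ((continuousOn_const.sub cl).mul (c3.sub c4))).sub
      ((continuousOn_const.mul hφcomp).add ct)
  have hper (t x : ℝ) : (fun x => u x t) (x + L) = (fun x => u x t) x := hu_per x t
  have hparam : ∀ t ∈ Icc 0 T, ∀ P ∈ increments L (fun x => u x t),
      ∀ Q ∈ increments L (fun x => u x t), ∀ l ∈ Icc (0:ℝ) 1,
      2 * φ ((l * P.1 + (1 - l) * Q.1) / 2) t + ε * (1 + t) < l * P.2 + (1 - l) * Q.2 →
      ∃ p ∈ D, Z p =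
        l * P.2 + (1 - l) * Q.2 - (2 * φ ((l * P.1 + (1 - l) * Q.1) / 2) t + ε * (1 + t)) := by
    intro t ht P hP Q hQ l hl h
    have hmem := hedge t ht P hP Q hQ l hl h
    obtain ⟨x₁, hx₁, s₁, hs₁, rfl⟩ := (mem_increments_iff_of_periodic hL (hper t)).1 hP
    obtain ⟨x₂, hx₂, s₂, hs₂, rfl⟩ := (mem_increments_iff_of_periodic hL (hper t)).1 hQ
    exact ⟨(l, x₁, s₁, x₂, s₂, t), ⟨⟨hl, hx₁, hs₁, hx₂, hs₂, ht⟩, hmem⟩, rfl⟩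
  obtain ⟨p, hpD, hpZ⟩ := hparam t ht P hP Q hQ l hl hlt
  obtain ⟨q, hqD, hqmax⟩ := hDcompact.exists_isMaxOn ⟨p, hpD⟩ hZ
  have hqpos : 0 < Z q := by
    have : Z p ≤ Z q := hqmax hpD
    linarith
  have hall : ∀ t ∈ Icc 0 T, ChordsBelow (increments L fun x => u x t)
      fun s => 2 * φ (s / 2) t + (ε * (1 + t) + Z q) := by
    intro t ht P hP Q hQ l hl
    by_contra! h
    obtain ⟨p', hp', hpZ'⟩ := hparam t ht P hP Q hQ l hl (by linarith)
    have : Z p' ≤ Z q := hqmax hp'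
    linarith
  obtain ⟨l', x₁, s₁, x₂, s₂, t₀⟩ := q
  obtain ⟨⟨hl', -, hs₁, -, hs₂, ht₀⟩, hS₁, hS₂⟩ := hqD
  have hs : l' * s₁ + (1 - l') * s₂ ∈ Ioo 0 L :=
    ⟨hδpos.trans_le hS₁, hS₂.trans_lt (sub_lt_self L hδpos)⟩
  have ht₀pos : 0 < t₀ := by
    refine lt_of_le_of_ne ht₀.1 ?_
    rintro rfl
    have hv : Continuous fun x => u x 0 := continuous_iff_continuousAt.2 fun x =>
      (hu_reg.2.1 (x, 0) ⟨trivial, ht₀⟩).continuousAt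
    have hφ0 : ContinuousOn (fun z => φ z 0) (Ioo 0 (L/2)) := by
      refine hφcont.comp (f := fun z => (z, (0:ℝ))) (by fun_prop) fun z hz => ?_
      refine ⟨⟨Ioo_subset_Icc_self hz, self_mem_Ici⟩, ?_⟩
      rintro (h | h)
      · exact hz.1.ne' (congrArg Prod.fst h)
      · exact hz.2.ne (congrArg Prod.fst (mem_singleton_iff.1 h))
    have := chord_le_initial hv hψconc hψmod hφ0 hφψ ⟨x₁, s₁, hs₁, rfl⟩ ⟨x₂, s₂, hs₂, rfl⟩ hl' hs
    simp only [Z, S] at hqpos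
    simp only at this
    linarith
  refine not_touching hαpos ha_lower hu_reg hu_per hu_eq hφ hε hall ⟨ht₀pos, ht₀.2⟩ hl' hs₁ hs₂ hs
    (x₁ := x₁) (x₂ := x₂) ?_
  simp only [Z, S]
  ring

lemma memS_const_s17 (hL : 0 < L) (hψpos : ∀ z ∈ Ioo (0:ℝ) (L/2), 0 < ψ z)
    (hψconc : ConcaveOn ℝ (Ioo 0 (L/2)) ψ) : MemS α L ψ fun _ _ => 2 * ψ (L / 4) := by
  have hX : pderivX (fun _ _ => 2 * ψ (L / 4)) = fun _ _ => 0 := by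
    funext x t
    simp [pderivX]
  have hXX : pderivXX (fun _ _ => 2 * ψ (L / 4)) = fun _ _ => 0 := by
    funext x t
    simp [pderivXX, hX]
  have hT : pderivT (fun _ _ => 2 * ψ (L / 4)) = fun _ _ => 0 := by
    funext x t
    simp [pderivT]
  have hmid : 0 < ψ (L / 4) := hψpos _ ⟨by linarith, by linarith⟩
  refine ⟨fun _ _ _ _ => by positivity, continuousOn_const, ?_, ?_, fun z hz => ?_⟩
  · simp only [RegularOn, hX, hXX, hT]
    exact ⟨continuousOn_const, fun _ _ => differentiableAt_const _,
      fun _ _ => differentiableAt_const _, fun _ _ => differentiableAt_const _,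
      continuousOn_const, continuousOn_const, continuousOn_const⟩
  · simp [hX, hXX, hT]
  · have hz' : L / 2 - z ∈ Ioo 0 (L/2) := ⟨by linarith [hz.2], by linarith [hz.1]⟩
    have h := hψconc.2 hz hz' (show (0:ℝ) ≤ 1 / 2 by norm_num) (show (0:ℝ) ≤ 1 / 2 by norm_num)
      (by norm_num)
    simp only [smul_eq_mul] at h
    rw [show 1 / 2 * z + 1 / 2 * (L / 2 - z) = L / 4 by ring] at h
    linarith [hψpos _ hz']

end Comparison

theorem modulus_bound_general_coefficients
    (α : ℝ → ℝ) (hα : Continuous α) (hαpos : ∀ p, 0 < α p)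
    (L T : ℝ) (hL : 0 < L) (hT : 0 < T)
    (a : ℝ → ℝ → ℝ → ℝ → ℝ)
    (ha_cont : Continuous fun q : ℝ × ℝ × ℝ × ℝ => a q.1 q.2.1 q.2.2.1 q.2.2.2)
    (ha_per : ∀ x t w p : ℝ, a (x + L) t w p = a x t w p)
    (ha_lower : ∀ x t w p : ℝ, α p ≤ a x t w p)
    (u : ℝ → ℝ → ℝ)
    (hu_reg : RegularOn u (univ ×ˢ Icc 0 T))
    (hu_per : ∀ x t : ℝ, u (x + L) t = u x t)
    (hu_eq : ∀ x : ℝ, ∀ t ∈ Icc (0:ℝ) T,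
      pderivT u x t = a x t (u x t) (pderivX u x t) * pderivXX u x t)
    (ψ : ℝ → ℝ)
    (hψpos : ∀ z ∈ Ioo (0:ℝ) (L/2), 0 < ψ z)
    (hψconc : ConcaveOn ℝ (Ioo 0 (L/2)) ψ)
    (hψmod : IsModulus L ψ (fun x => u x 0)) :
    ∀ t ∈ Ioc (0:ℝ) T,
      IsModulus L (fun z => psiPlus α L ψ z t) (fun x => u x t) := by
  intro t ht
  have ht' : t ∈ Icc 0 T := Ioc_subset_Icc_self ht
  have hupper : ∀ x y : ℝ, 0 < y - x → y - x < L →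
      u y t - u x t ≤ 2 * psiPlus α L ψ ((y - x) / 2) t := by
    intro x y h0 h1
    have hle : (u y t - u x t) / 2 ≤ psiPlus α L ψ ((y - x) / 2) t := by
      refine le_csInf ⟨_, _, memS_const_s17 hL hψpos hψconc, rfl⟩ ?_
      rintro _ ⟨φ, hφ, rfl⟩
      refine le_of_forall_pos_le_add fun η hη => ?_
      have hK := chordsBelow_of_memS hαpos hL ha_lower hu_reg hu_per hu_eq hψconc hψmod hφ
        (show 0 < η / (1 + t) by linarith [ht.1, div_pos hη (show 0 < 1 + t by linarith [ht.1])])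
        ht'
      have hmem : (y - x, u y t - u x t) ∈ increments L fun x => u x t :=
        ⟨x, y - x, ⟨h0.le, h1.le⟩, by simp⟩
      have := hK _ hmem _ hmem 1 (by simp)
      rw [div_mul_cancel₀ _ (show 1 + t ≠ 0 by linarith [ht.1])] at this
      simp only [one_mul, sub_self, zero_mul, add_zero] at this
      linarith
    linarith
  refine fun x y h0 h1 => ⟨?_, hupper x y h0 h1⟩
  have h := hupper y (x + L) (by linarith) (by linarith)
  rw [hu_per, show x + L - y = L + x - y by ring] at h
  simp only
  linarith
end
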